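/- The rational cohomology of SL₃(ℤ) is that of a point: for every k ≥ 1, H^k(SL₃(ℤ); ℚ) = 0. (Soulé) -/

import Mathlib

open CategoryTheory

/-- A linear representation that decomposes the identity as a locally finite sum of `G`-translates
of a single linear endomorphism is projective. -/
theorem Rep.projective_of_locallyFinite_partition {k G : Type} [Field k] [Group G] (M : Rep.{0} k G)
    (i : M →ₗ[k] (G →₀ M)) (hi : ∀ h g m, i (M.ρ h m) g = i m (h⁻¹ * g))
    (hsum : ∀ m, (i m).sum (fun g x => M.ρ g x) = m) : Projective M := by
  refine ⟨fun {E X} f e he => ?_⟩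
  have hsurj := (Rep.epi_iff_surjective e).1 he
  obtain ⟨s, hs⟩ := Module.projective_lifting_property e.hom.toLinearMap f.hom.toLinearMap hsurj
  have hs' : ∀ x, e.hom (s x) = f.hom x := fun x => congrArg (fun φ => φ x) hs
  let F : M →ₗ[k] E := (Finsupp.lsum k fun g => (E.ρ g : E →ₗ[k] E) ∘ₗ s) ∘ₗ i
  have hF : ∀ m, F m = (i m).sum fun g x => E.ρ g (s x) := fun m => by
    simp only [F, LinearMap.comp_apply, Finsupp.lsum_apply]
    rfl
  have hshift : ∀ h m, i (M.ρ h m) = (i m).embDomain (Equiv.mulLeft h).toEmbedding := by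
    intro h m
    ext g
    rw [hi]
    have := Finsupp.embDomain_apply_self (Equiv.mulLeft h).toEmbedding (i m) (h⁻¹ * g)
    simpa using this.symm
  refine ⟨Rep.ofHom (σ := E.ρ) (ρ := M.ρ) ⟨F, fun h => ?_⟩, ?_⟩
  · ext m
    simp only [LinearMap.comp_apply, hF, hshift]
    rw [Finsupp.sum_embDomain, Finsupp.sum, Finsupp.sum, map_sum]
    simp [map_mul]
  · ext m
    change e.hom (F m) = f.hom m
    conv_rhs => rw [← hsum m]
    rw [hF, Finsupp.sum, Finsupp.sum, map_sum, map_sum]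
    refine Finset.sum_congr rfl fun g _ => ?_
    rw [Rep.hom_comm_apply, Rep.hom_comm_apply, hs']

theorem groupCohomology.subsingleton_of_resolution {k G : Type} [Field k] [Group G]
    (P : ℕ → Rep.{0} k G) (d : ∀ n, P (n + 1) ⟶ P n) (ε : P 0 ⟶ Rep.trivial k G k)
    (hP : ∀ n, Projective (P n))
    (hdd : ∀ n x, (d n).hom ((d (n + 1)).hom x) = 0)
    (hεd : ∀ x, ε.hom ((d 0).hom x) = 0)
    (hε : Function.Surjective ε.hom)
    (hexact₀ : ∀ x, ε.hom x = 0 → ∃ y, (d 0).hom y = x)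
    (hexact : ∀ n x, (d n).hom x = 0 → ∃ y, (d (n + 1)).hom y = x)
    (A : Rep.{0} k G) (hhom : ∀ n (f : P (n + 1) ⟶ A), f = 0) (n : ℕ) (hn : 1 ≤ n) :
    Subsingleton (groupCohomology A n) := by
  have hdd' : ∀ n, d (n + 1) ≫ d n = 0 := fun n => by ext x; exact hdd n x
  let C : ChainComplex (Rep.{0} k G) ℕ := ChainComplex.of P d hdd'
  have hCd : ∀ n, C.d (n + 1) n = d n := fun n => ChainComplex.of_d ..
  have hεd' : C.d 1 0 ≫ ε = 0 := by rw [hCd 0]; ext x; exact hεd x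
  let π : C ⟶ (ChainComplex.single₀ _).obj (Rep.trivial k G k) :=
    (ChainComplex.toSingle₀Equiv _ _).symm ⟨ε, hεd'⟩
  have hπ₀ : π.f 0 = ε := by
    simp [π, ChainComplex.toSingle₀Equiv]
  have hπ : QuasiIso π := ⟨fun m => by
    cases m with
    | zero =>
      rw [ChainComplex.quasiIsoAt₀_iff, ShortComplex.quasiIso_iff_of_zeros' _ rfl rfl rfl]
      constructor
      · apply (forget₂ _ (ModuleCat k)).reflects_exact_of_faithful
        rw [ShortComplex.moduleCat_exact_iff]
        intro x hx
        obtain ⟨y, hy⟩ := hexact₀ x (by rw [← hπ₀]; exact hx)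
        refine ⟨y, ?_⟩
        rw [← hy, ← hCd]
        rfl
      · rw [Rep.epi_iff_surjective]
        change Function.Surjective (π.f 0).hom
        rw [hπ₀]
        exact hε
    | succ m =>
      rw [quasiIsoAt_iff_exactAt' (hL := ChainComplex.exactAt_succ_single_obj ..),
        HomologicalComplex.exactAt_iff' _ (m + 2) (m + 1) m (by simp) (by simp)]
      apply (forget₂ _ (ModuleCat k)).reflects_exact_of_faithful
      rw [ShortComplex.moduleCat_exact_iff]
      intro x hx
      obtain ⟨y, hy⟩ := hexact m x (by rw [← hCd]; exact hx)
      refine ⟨y, ?_⟩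
      rw [← hy, ← hCd]
      rfl⟩
  let R : ProjectiveResolution (Rep.trivial k G k) :=
    { complex := C, projective := hP, π := π, quasiIso := hπ }
  obtain ⟨m, rfl⟩ : ∃ m, n = m + 1 := ⟨n - 1, by omega⟩
  have hz : Limits.IsZero ((R.complex.linearYonedaObj k A).X (m + 1)) := by
    refine ModuleCat.isZero_of_iff_subsingleton.2 ⟨fun a b => ?_⟩
    exact (hhom m a).trans (hhom m b).symm
  have hex : (R.complex.linearYonedaObj k A).ExactAt (m + 1) :=
    ShortComplex.exact_of_isZero_X₂ ((R.complex.linearYonedaObj k A).sc (m + 1)) hz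
  exact ModuleCat.isZero_iff_subsingleton.1
    (hex.isZero_homology.of_iso (groupCohomologyIso A (m + 1) R))

/-- Combinatorial data of a tessellation whose top-dimensional cells are the translates of a finite
vertex set `base`; `Full` singles out the faces that do not lie at infinity. -/
structure FrameSystem (G V : Type) [Group G] [MulAction G V] where
  base : Finset V
  Full : Set V → Prop
  full_mono : ∀ {S T : Set V}, S ⊆ T → Full S → Full T
  full_smul : ∀ (g : G) {n : ℕ} (t : Fin n → V), Full (Set.range t) → Full (Set.range (g • t))
  proper : ∀ {n : ℕ} (t : Fin n → V), Full (Set.range t) → {g : G | ∀ j, g • t j ∈ base}.Finite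

namespace FrameSystem

variable {G V : Type} [Group G] [MulAction G V] (S : FrameSystem G V)

/-- The translate of the base frame by `g⁻¹`. -/
def frame (g : G) : Set V := {x | g • x ∈ S.base}

theorem mem_frame {g : G} {x : V} : x ∈ S.frame g ↔ g • x ∈ S.base := Iff.rfl

theorem frame_finite (g : G) : (S.frame g).Finite :=
  S.base.finite_toSet.preimage (MulAction.injective g).injOn

theorem smul_mem_frame {g h : G} {x : V} : h • x ∈ S.frame g ↔ x ∈ S.frame (g * h) := by
  simp [mem_frame, mul_smul]

/-- An ordered cell: a full tuple of vertices contained in a frame. -/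
def IsCell {n : ℕ} (t : Fin n → V) : Prop :=
  S.Full (Set.range t) ∧ ∃ g, ∀ j, t j ∈ S.frame g

variable {S}

theorem IsCell.smul {n : ℕ} {t : Fin n → V} (ht : S.IsCell t) (g : G) : S.IsCell (g • t) := by
  obtain ⟨h₁, h, h₂⟩ := ht
  exact ⟨S.full_smul g t h₁, h * g⁻¹, fun j => by
    rw [Pi.smul_apply, smul_mem_frame, inv_mul_cancel_right]; exact h₂ j⟩

theorem isCell_smul_iff {n : ℕ} {t : Fin n → V} (g : G) : S.IsCell (g • t) ↔ S.IsCell t :=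
  ⟨fun h => by simpa using h.smul g⁻¹, fun h => h.smul g⟩

theorem isCell_comp_perm_iff {n : ℕ} {t : Fin n → V} (π : Equiv.Perm (Fin n)) :
    S.IsCell (t ∘ π) ↔ S.IsCell t := by
  unfold IsCell
  rw [EquivLike.range_comp]
  refine and_congr_right fun _ => exists_congr fun g => ?_
  exact π.forall_congr_left.trans (by simp)

theorem range_succAbove_subset {n : ℕ} (t : Fin (n + 1) → V) (i : Fin (n + 1)) :
    Set.range (t ∘ i.succAbove) ⊆ Set.range t := Set.range_comp_subset_range _ _

variable (S)

/-- Alternating finitely supported functions on ordered cells with `n` vertices. -/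
def chain (n : ℕ) : Submodule ℚ ((Fin n → V) →₀ ℚ) where
  carrier := {f | (∀ t, f t ≠ 0 → S.IsCell t) ∧
    ∀ (t : Fin n → V) (π : Equiv.Perm (Fin n)), f (t ∘ π) = (Equiv.Perm.sign π : ℤ) * f t}
  add_mem' := by
    rintro a b ⟨ha, ha'⟩ ⟨hb, hb'⟩
    refine ⟨fun t ht => ?_, fun t π => by simp [ha', hb', mul_add]⟩
    by_contra h
    exact ht (by simp [not_not.1 (mt (ha t) h), not_not.1 (mt (hb t) h)])
  zero_mem' := by simp
  smul_mem' := by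
    rintro c a ⟨ha, ha'⟩
    refine ⟨fun t ht => ha t fun h => ht (by simp [h]), fun t π => ?_⟩
    simp [ha', mul_left_comm]

variable {S}

theorem isCell_of_ne_zero {n : ℕ} {f : (Fin n → V) →₀ ℚ} (hf : f ∈ S.chain n) {t : Fin n → V}
    (h : f t ≠ 0) : S.IsCell t := hf.1 t h

theorem apply_eq_zero {n : ℕ} {f : (Fin n → V) →₀ ℚ} (hf : f ∈ S.chain n) {t : Fin n → V}
    (h : ¬ S.IsCell t) : f t = 0 := not_not.1 (mt (hf.1 t) h)

theorem apply_eq_zero_of_not_injective {n : ℕ} {f : (Fin n → V) →₀ ℚ} (hf : f ∈ S.chain n)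
    {t : Fin n → V} (h : ¬ Function.Injective t) : f t = 0 := by
  simp only [Function.Injective, not_forall] at h
  obtain ⟨a, b, hab, hne⟩ := h
  have h1 := hf.2 t (Equiv.swap a b)
  have h2 : t ∘ Equiv.swap a b = t := by
    ext x
    rcases eq_or_ne x a with rfl | hxa
    · simp [hab]
    rcases eq_or_ne x b with rfl | hxb
    · simp [hab]
    simp [Equiv.swap_apply_of_ne_of_ne hxa hxb]
  rw [h2, Equiv.Perm.sign_swap hne] at h1
  push_cast at h1
  linarith

/-- A function that changes sign under adjacent transpositions is alternating. -/
theorem alternating_of_adjacent {n : ℕ} {F : (Fin (n + 1) → V) → ℚ}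
    (hF : ∀ t (a : Fin n), F (t ∘ Equiv.swap a.castSucc a.succ) = -F t)
    (t : Fin (n + 1) → V) (π : Equiv.Perm (Fin (n + 1))) :
    F (t ∘ π) = (Equiv.Perm.sign π : ℤ) * F t := by
  have hπ : π ∈ Submonoid.closure (Set.range fun i : Fin n => Equiv.swap i.castSucc i.succ) := by
    rw [Equiv.Perm.mclosure_swap_castSucc_succ]; trivial
  induction hπ using Submonoid.closure_induction generalizing t with
  | mem x hx =>
    obtain ⟨a, rfl⟩ := hx
    rw [hF, Equiv.Perm.sign_swap a.castSucc_lt_succ.ne]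
    simp
  | one => simp
  | mul x y _ _ hx hy =>
    rw [Equiv.Perm.coe_mul, ← Function.comp_assoc, hy, hx]
    simp
    ring

theorem swap_succAbove {n : ℕ} (a : Fin n) :
    (Equiv.swap a.castSucc a.succ : Fin (n + 1) → Fin (n + 1)) ∘ a.castSucc.succAbove
      = a.succ.succAbove := by
  ext1 j
  simp only [Function.comp_apply]
  rcases lt_trichotomy j a with h | rfl | h
  · have h1 : j.castSucc < a.castSucc := h
    rw [Fin.succAbove_of_castSucc_lt _ _ h1, Fin.succAbove_of_castSucc_lt _ _
      (h1.trans a.castSucc_lt_succ),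
      Equiv.swap_apply_of_ne_of_ne h1.ne (h1.trans a.castSucc_lt_succ).ne]
  · simp
  · have h1 : a.castSucc < j.castSucc := h
    have h2 : a.succ ≤ j.castSucc := h
    rw [Fin.succAbove_of_le_castSucc _ _ h1.le, Fin.succAbove_of_le_castSucc _ _ h2,
      Equiv.swap_apply_of_ne_of_ne]
    · exact (h1.trans j.castSucc_lt_succ).ne'
    · exact (Fin.succ_lt_succ_iff.2 h).ne'

/-- The alternating sum of the values at the faces of a tuple. -/
def faceSum {n : ℕ} (f : (Fin n → V) → ℚ) (t : Fin (n + 1) → V) : ℚ :=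
  ∑ i : Fin (n + 1), (-1) ^ (i : ℕ) * f (t ∘ i.succAbove)

theorem faceSum_swap {n : ℕ} {f : (Fin n → V) → ℚ}
    (hf : ∀ t (π : Equiv.Perm (Fin n)), f (t ∘ π) = (Equiv.Perm.sign π : ℤ) * f t)
    (t : Fin (n + 1) → V) (a : Fin n) :
    faceSum f (t ∘ Equiv.swap a.castSucc a.succ) = - faceSum f t := by
  unfold faceSum
  rw [← Equiv.sum_comp (Equiv.swap a.castSucc a.succ), ← Finset.sum_neg_distrib]
  refine Finset.sum_congr rfl fun i _ => ?_
  rcases eq_or_ne i a.castSucc with rfl | h1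
  · rw [Equiv.swap_apply_left, Function.comp_assoc, ← swap_succAbove a, ← Function.comp_assoc _ _
      a.castSucc.succAbove]
    have : (Equiv.swap a.castSucc a.succ : Fin (n + 1) → Fin (n + 1)) ∘
      (Equiv.swap a.castSucc a.succ) = id := by ext1; simp
    rw [this]
    simp [pow_succ]
  rcases eq_or_ne i a.succ with rfl | h2
  · rw [Equiv.swap_apply_right, Function.comp_assoc, swap_succAbove]
    simp [pow_succ]
  rw [Equiv.swap_apply_of_ne_of_ne h1 h2]
  obtain ⟨b, hb⟩ := Fin.exists_succAbove_eq h1.symm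
  obtain ⟨c, hc⟩ := Fin.exists_succAbove_eq h2.symm
  have hbc : b ≠ c := by
    rintro rfl
    exact a.castSucc_lt_succ.ne (hb.symm.trans hc)
  have : (Equiv.swap a.castSucc a.succ : Fin (n + 1) → Fin (n + 1)) ∘ i.succAbove
      = i.succAbove ∘ Equiv.swap b c := by
    ext1 x
    rw [Function.comp_apply, Function.comp_apply, ← hb, ← hc,
      ← i.succAbove_right_injective.map_swap]
  rw [Function.comp_assoc, this, ← Function.comp_assoc, hf, Equiv.Perm.sign_swap hbc]
  simp

theorem faceSum_faceSum {n : ℕ} (f : (Fin n → V) → ℚ) (t : Fin (n + 2) → V) :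
    faceSum (faceSum f) t = 0 := by
  unfold faceSum
  simp only [Finset.mul_sum]
  rw [← Finset.sum_product']
  refine Finset.sum_involution (fun p _ => (p.1.succAbove p.2, p.2.predAbove p.1)) ?_ ?_ ?_ ?_
  · rintro ⟨i, j⟩ -
    have h1 : (t ∘ (i.succAbove j).succAbove) ∘ (j.predAbove i).succAbove
        = (t ∘ i.succAbove) ∘ j.succAbove := by
      ext1 k
      simp only [Function.comp_apply, Fin.succAbove_succAbove_succAbove_predAbove]
    have h2 := Fin.neg_one_pow_succAbove_add_predAbove (R := ℚ) i j
    simp only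
    rw [h1, ← mul_assoc, ← mul_assoc, ← pow_add, ← pow_add, h2]
    ring
  · rintro ⟨i, j⟩ - - h
    exact Fin.succAbove_ne i j (congrArg Prod.fst h)
  · simp
  · rintro ⟨i, j⟩ -
    have h := Fin.succAbove_succAbove_predAbove i j
    ext1
    · exact h
    · simp only
      have h' := Fin.succAbove_succAbove_predAbove (i.succAbove j) (j.predAbove i)
      rw [h] at h'
      exact Fin.succAbove_right_injective h'

theorem faceSum_eq_zero {n : ℕ} {f : (Fin n → V) →₀ ℚ} (hf : f ∈ S.chain n)
    {t : Fin (n + 1) → V} {g : G} (hg : ∀ j, t j ∈ S.frame g) (ht : ¬ S.IsCell t) :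
    faceSum f t = 0 := by
  refine Finset.sum_eq_zero fun i _ => ?_
  rw [apply_eq_zero hf, mul_zero]
  exact fun h => ht ⟨S.full_mono (range_succAbove_subset t i) h.1, g, hg⟩

variable (S)

open Classical in
theorem differential_support {n : ℕ} (f : (Fin n → V) →₀ ℚ) :
    (Function.support fun t => if S.IsCell t ∧ f ∈ S.chain n then faceSum f t else 0).Finite := by
  by_cases hf : f ∈ S.chain n
  swap
  · simp [hf]
  have hfin : (⋃ s ∈ (f.support : Set (Fin n → V)),
      ⋃ g ∈ {g : G | S.Full (Set.range s) ∧ ∀ j, g • s j ∈ S.base},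
        {t : Fin (n + 1) → V | ∀ j, t j ∈ S.frame g}).Finite := by
    refine f.support.finite_toSet.biUnion fun s _ => Set.Finite.biUnion ?_ fun g _ => ?_
    · by_cases h : S.Full (Set.range s)
      · simpa [h] using S.proper s h
      · simp [h]
    · have := Set.Finite.pi fun _ : Fin (n + 1) => S.frame_finite g
      refine this.subset fun t ht j _ => ht j
  refine hfin.subset fun t ht => ?_
  have h1 : S.IsCell t := by
    by_contra h
    simp [h] at ht
  have h2 : faceSum f t ≠ 0 := by simpa [h1, hf] using ht
  obtain ⟨i, -, hi⟩ := Finset.exists_ne_zero_of_sum_ne_zero h2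
  have hi' : f (t ∘ i.succAbove) ≠ 0 := right_ne_zero_of_mul hi
  obtain ⟨-, g, hg⟩ := h1
  simp only [Set.mem_iUnion]
  exact ⟨t ∘ i.succAbove, by simpa using hi', g,
    ⟨(isCell_of_ne_zero hf hi').1, fun j => hg (i.succAbove j)⟩, hg⟩

open Classical in
/-- The coboundary-type differential, summing over the codimension-one faces of a cell. -/
noncomputable def differential (n : ℕ) : S.chain n →ₗ[ℚ] S.chain (n + 1) where
  toFun f := ⟨Finsupp.ofSupportFinite _ (S.differential_support f.1), by
    have happ : ∀ t, Finsupp.ofSupportFinite _ (S.differential_support f.1) t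
        = if S.IsCell t then faceSum f.1 t else 0 := fun t => by
      simp [Finsupp.ofSupportFinite_coe]
    refine ⟨fun t ht => ?_, fun t π => ?_⟩
    · by_contra h
      rw [happ, if_neg h] at ht
      exact ht rfl
    · rw [happ, happ, isCell_comp_perm_iff]
      split_ifs
      · exact alternating_of_adjacent (faceSum_swap f.2.2) t π
      · simp⟩
  map_add' f g := by
    ext t
    simp only [Finsupp.ofSupportFinite_coe, Submodule.coe_add, Finsupp.add_apply, f.2, g.2,
      Submodule.add_mem, and_true, faceSum]
    split_ifs <;> simp [mul_add, Finset.sum_add_distrib]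
  map_smul' c f := by
    ext t
    simp only [Finsupp.ofSupportFinite_coe, Submodule.coe_smul, Finsupp.smul_apply, f.2,
      Submodule.smul_mem, and_true, faceSum, RingHom.id_apply]
    split_ifs
    · simp [Finset.mul_sum, mul_left_comm]
    · simp

theorem differential_apply_of_isCell {n : ℕ} (f : S.chain n) {t : Fin (n + 1) → V}
    (ht : S.IsCell t) : (S.differential n f).1 t = faceSum f.1 t := by
  simp [differential, Finsupp.ofSupportFinite_coe, ht]

theorem differential_apply {n : ℕ} (f : S.chain n) {t : Fin (n + 1) → V} {g : G}
    (hg : ∀ j, t j ∈ S.frame g) : (S.differential n f).1 t = faceSum f.1 t := by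
  by_cases ht : S.IsCell t
  · exact S.differential_apply_of_isCell f ht
  · rw [faceSum_eq_zero f.2 hg ht, apply_eq_zero (S.differential n f).2 ht]

theorem differential_differential {n : ℕ} (f : S.chain n) :
    S.differential (n + 1) (S.differential n f) = 0 := by
  ext t
  by_cases ht : S.IsCell t
  · rw [S.differential_apply_of_isCell _ ht]
    obtain ⟨-, g, hg⟩ := ht
    have : ∀ i : Fin (n + 2), (S.differential n f).1 (t ∘ i.succAbove)
        = faceSum f.1 (t ∘ i.succAbove) :=
      fun i => S.differential_apply f (g := g) fun j => hg _
    have h2 := faceSum_faceSum f.1 t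
    rw [faceSum] at h2 ⊢
    simpa [this] using h2
  · exact apply_eq_zero (S.differential (n + 1) _).2 ht

/-- Translation of chains. -/
noncomputable def translate (n : ℕ) : Representation ℚ G (S.chain n) where
  toFun g := ((Finsupp.domLCongr (MulAction.toPerm g) :
      ((Fin n → V) →₀ ℚ) ≃ₗ[ℚ] ((Fin n → V) →₀ ℚ)) :
      ((Fin n → V) →₀ ℚ) →ₗ[ℚ] ((Fin n → V) →₀ ℚ)).restrict fun f hf => by
    refine ⟨fun t ht => ?_, fun t π => ?_⟩
    · have h : S.IsCell (g⁻¹ • t) := hf.1 _ ht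
      rwa [isCell_smul_iff] at h
    · exact hf.2 (g⁻¹ • t) π
  map_one' := by
    ext f t
    change f.1 ((1 : G)⁻¹ • t) = f.1 t
    simp
  map_mul' g h := by
    ext f t
    change f.1 ((g * h)⁻¹ • t) = f.1 (h⁻¹ • g⁻¹ • t)
    rw [mul_inv_rev, mul_smul]

theorem translate_apply {n : ℕ} (g : G) (f : S.chain n) (t : Fin n → V) :
    (S.translate n g f).1 t = f.1 (g⁻¹ • t) := rfl

theorem differential_translate {n : ℕ} (g : G) (f : S.chain n) :
    S.differential n (S.translate n g f) = S.translate (n + 1) g (S.differential n f) := by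
  ext t
  rw [translate_apply]
  by_cases ht : S.IsCell t
  · rw [S.differential_apply_of_isCell _ ht, S.differential_apply_of_isCell _ (ht.smul _)]
    rfl
  · rw [apply_eq_zero (S.differential n _).2 ht,
      apply_eq_zero (S.differential n f).2 (by rwa [isCell_smul_iff])]

end FrameSystem

namespace FrameSystem

variable {G V : Type} [Group G] [MulAction G V] (S : FrameSystem G V)

/-- The representation of `G` on chains. -/
noncomputable def chainRep (n : ℕ) : Rep.{0} ℚ G := Rep.of (S.translate n)

/-- The group elements moving a tuple into the base frame. -/
def carriers {n : ℕ} (t : Fin n → V) : Set G := {g | ∀ j, g • t j ∈ S.base}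

variable {S} in
theorem IsCell.carriers_finite {n : ℕ} {t : Fin n → V} (ht : S.IsCell t) : (S.carriers t).Finite :=
  S.proper t ht.1

theorem ncard_carriers_smul {n : ℕ} (g : G) (t : Fin n → V) :
    (S.carriers (g • t)).ncard = (S.carriers t).ncard := by
  rw [← Set.ncard_image_of_injective (S.carriers (g • t)) (mul_left_injective g)]
  congr 1
  ext h
  simp only [Set.mem_image, carriers, Set.mem_ofPred_eq]
  constructor
  · rintro ⟨k, hk, rfl⟩ j
    simpa [mul_smul] using hk j
  · intro hh
    exact ⟨h * g⁻¹, fun j => by simpa [mul_smul] using hh j, by simp⟩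

theorem carriers_comp_perm {n : ℕ} (t : Fin n → V) (π : Equiv.Perm (Fin n)) :
    S.carriers (t ∘ π) = S.carriers t := by
  ext g
  exact π.forall_congr_left.trans (by simp [carriers])

open Classical in
/-- The weight of a tuple in the partition of unity attached to the base frame. -/
noncomputable def weight {n : ℕ} (t : Fin n → V) : ℚ :=
  if ∀ j, t j ∈ S.base then ((S.carriers t).ncard : ℚ)⁻¹ else 0

open Classical in
theorem weight_comp_perm {n : ℕ} (t : Fin n → V) (π : Equiv.Perm (Fin n)) :
    S.weight (t ∘ π) = S.weight t := by
  have h : (∀ j, (t ∘ π) j ∈ S.base) ↔ ∀ j, t j ∈ S.base := π.forall_congr_left.trans (by simp)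
  rw [weight, weight, carriers_comp_perm]
  exact if_congr h rfl rfl

/-- Pointwise multiplication of chains by the weight. -/
noncomputable def cut (n : ℕ) : S.chain n →ₗ[ℚ] S.chain n where
  toFun f := ⟨Finsupp.onFinset f.1.support (fun t => S.weight t * f.1 t) fun t ht => by
      simpa using right_ne_zero_of_mul ht, by
    refine ⟨fun t ht => ?_, fun t π => ?_⟩
    · exact isCell_of_ne_zero f.2 (right_ne_zero_of_mul ht)
    · simp only [Finsupp.onFinset_apply, weight_comp_perm, f.2.2 t π]
      ring⟩
  map_add' f g := by ext t; simp [mul_add]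
  map_smul' c f := by ext t; simp [mul_left_comm]

theorem cut_apply {n : ℕ} (f : S.chain n) (t : Fin n → V) :
    (S.cut n f).1 t = S.weight t * f.1 t := rfl

theorem finsum_weight {n : ℕ} {t : Fin n → V} (ht : S.IsCell t) :
    ∑ᶠ g : G, S.weight (g⁻¹ • t) = 1 := by
  classical
  have hfin := ht.carriers_finite
  have hne : (S.carriers t).ncard ≠ 0 := by
    obtain ⟨g, hg⟩ := ht.2
    exact (Set.ncard_pos hfin).2 ⟨g, hg⟩ |>.ne'
  rw [finsum_eq_sum_of_support_subset (s := hfin.toFinset.image fun g => g⁻¹)]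
  · rw [Finset.sum_image inv_injective.injOn]
    have : ∀ g ∈ hfin.toFinset, S.weight (g⁻¹⁻¹ • t) = ((S.carriers t).ncard : ℚ)⁻¹ := by
      intro g hg
      rw [inv_inv, weight, ncard_carriers_smul, if_pos]
      exact hfin.mem_toFinset.1 hg
    rw [Finset.sum_congr rfl this, Finset.sum_const, ← Set.ncard_eq_toFinset_card _ hfin]
    simp [hne]
  · intro g hg
    simp only [Finset.coe_image, Set.Finite.coe_toFinset, Set.mem_image]
    refine ⟨g⁻¹, ?_, by simp⟩
    by_contra h
    exact hg (if_neg h)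

theorem cut_translate_support {n : ℕ} (f : S.chain n) :
    (Function.support fun g : G => S.cut n (S.translate n g⁻¹ f)).Finite := by
  have hfin : (⋃ s ∈ (f.1.support : Set (Fin n → V)),
      (fun g : G => g⁻¹) ⁻¹' (S.carriers s)).Finite :=
    f.1.support.finite_toSet.biUnion fun s hs =>
      (isCell_of_ne_zero f.2 (by simpa using hs)).carriers_finite.preimage inv_injective.injOn
  refine hfin.subset fun g hg => ?_
  obtain ⟨t, ht⟩ : ∃ t, (S.cut n (S.translate n g⁻¹ f)).1 t ≠ 0 := by
    by_contra! h
    exact hg (Subtype.ext (Finsupp.ext h))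
  rw [cut_apply, translate_apply, inv_inv] at ht
  have hw : ∀ j, t j ∈ S.base := by
    by_contra h
    exact left_ne_zero_of_mul ht (if_neg h)
  simp only [Set.mem_iUnion]
  refine ⟨g • t, by simpa using right_ne_zero_of_mul ht, fun j => ?_⟩
  simpa using hw j

theorem projective_chainRep (n : ℕ) : Projective (S.chainRep n) := by
  let i : S.chain n →ₗ[ℚ] (G →₀ S.chain n) :=
    { toFun := fun f => Finsupp.ofSupportFinite _ (S.cut_translate_support f)
      map_add' := fun f g => by ext1 h; simp [Finsupp.ofSupportFinite_coe]
      map_smul' := fun c f => by ext1 h; simp [Finsupp.ofSupportFinite_coe] }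
  have hi : ∀ f g, i f g = S.cut n (S.translate n g⁻¹ f) := fun f g => rfl
  refine Rep.projective_of_locallyFinite_partition (S.chainRep n) i
    (fun h g (m : S.chain n) => ?_) fun (m : S.chain n) => ?_
  · change i (S.translate n h m) g = i m (h⁻¹ * g)
    rw [hi, hi, mul_inv_rev, inv_inv, map_mul, Module.End.mul_apply]
  · change ((i m).sum fun g x => S.translate n g x) = m
    ext t
    let ev : S.chain n →ₗ[ℚ] ℚ := Finsupp.lapply t ∘ₗ (S.chain n).subtype
    change ev _ = m.1 t
    rw [Finsupp.sum, map_sum]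
    have hev : ∀ g, ev (S.translate n g (i m g)) = S.weight (g⁻¹ • t) * m.1 t := by
      intro g
      change (S.translate n g (i m g)).1 t = _
      rw [translate_apply, hi, cut_apply, translate_apply, inv_inv, smul_inv_smul]
    simp only [hev]
    rw [← Finset.sum_mul]
    by_cases hm : m.1 t = 0
    · simp [hm]
    · rw [← finsum_eq_sum_of_support_subset, finsum_weight S (isCell_of_ne_zero m.2 hm), one_mul]
      intro g hg
      rw [Finset.mem_coe, Finsupp.mem_support_iff, hi]
      intro h0
      have h1 := congrArg (fun x : S.chain n => x.1 (g⁻¹ • t)) h0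
      simp only [cut_apply, translate_apply, inv_inv, smul_inv_smul] at h1
      exact mul_ne_zero hg hm h1

/-- The alternating sum of the orderings of a tuple. -/
noncomputable def altSingle {n : ℕ} (t : Fin n → V) : (Fin n → V) →₀ ℚ :=
  ∑ π : Equiv.Perm (Fin n), Finsupp.single (t ∘ π) ((Equiv.Perm.sign π : ℤ) : ℚ)

open Classical in
theorem altSingle_apply {n : ℕ} (t s : Fin n → V) :
    altSingle t s = ∑ π : Equiv.Perm (Fin n), if t ∘ π = s then ((Equiv.Perm.sign π : ℤ) : ℚ)
      else 0 := by
  simp [altSingle, Finsupp.finsetSum_apply, Finsupp.single_apply]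

theorem altSingle_apply_comp {n : ℕ} (t s : Fin n → V) (σ : Equiv.Perm (Fin n)) :
    altSingle t (s ∘ σ) = (Equiv.Perm.sign σ : ℤ) * altSingle t s := by
  classical
  rw [altSingle_apply, altSingle_apply, ← Equiv.sum_comp (Equiv.mulRight σ), Finset.mul_sum]
  refine Finset.sum_congr rfl fun π _ => ?_
  have : t ∘ (Equiv.mulRight σ π : Equiv.Perm (Fin n)) = s ∘ σ ↔ t ∘ π = s := by
    rw [Equiv.coe_mulRight, Equiv.Perm.coe_mul, ← Function.comp_assoc]
    exact σ.surjective.injective_comp_right.eq_iff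
  simp only [this]
  split_ifs <;> simp [mul_comm]

theorem sign_mul_sign_cast {n : ℕ} (σ : Equiv.Perm (Fin n)) :
    ((Equiv.Perm.sign σ : ℤ) : ℚ) * ((Equiv.Perm.sign σ : ℤ) : ℚ) = 1 := by
  rcases Int.units_eq_one_or (Equiv.Perm.sign σ) with h | h <;> simp [h]

theorem altSingle_comp {n : ℕ} (t : Fin n → V) (σ : Equiv.Perm (Fin n)) :
    altSingle (t ∘ σ) = ((Equiv.Perm.sign σ : ℤ) : ℚ) • altSingle t := by
  classical
  ext s
  rw [Finsupp.smul_apply, altSingle_apply, altSingle_apply,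
    ← Equiv.sum_comp (Equiv.mulLeft σ) (fun π => if t ∘ π = s then _ else _), smul_eq_mul,
    Finset.mul_sum]
  refine Finset.sum_congr rfl fun π _ => ?_
  rw [Equiv.coe_mulLeft, Equiv.Perm.coe_mul, ← Function.comp_assoc]
  split_ifs <;> simp [← mul_assoc, sign_mul_sign_cast]

variable {S} in
theorem altSingle_mem {n : ℕ} {t : Fin n → V} (ht : S.IsCell t) : altSingle t ∈ S.chain n := by
  classical
  refine ⟨fun s hs => ?_, fun s σ => altSingle_apply_comp t s σ⟩
  rw [altSingle_apply] at hs
  obtain ⟨π, -, hπ⟩ := Finset.exists_ne_zero_of_sum_ne_zero hs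
  have : t ∘ π = s := by
    by_contra h
    exact hπ (if_neg h)
  rw [← this, isCell_comp_perm_iff]
  exact ht

theorem translate_altSingle {n : ℕ} {t : Fin n → V} (ht : S.IsCell t) (g : G) :
    S.translate n g ⟨altSingle t, altSingle_mem ht⟩
      = ⟨altSingle (g • t), altSingle_mem (ht.smul g)⟩ := by
  classical
  ext s
  rw [translate_apply]
  simp only [altSingle_apply]
  refine Finset.sum_congr rfl fun π _ => ?_
  have : t ∘ π = g⁻¹ • s ↔ (g • t) ∘ π = s := by
    rw [eq_inv_smul_iff]
    rfl
  simp only [this]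

theorem factorial_smul_eq_sum {n : ℕ} (f : S.chain n) :
    (n.factorial : ℚ) • f.1 = ∑ t ∈ f.1.support, f.1 t • altSingle t := by
  classical
  ext s
  simp only [Finsupp.smul_apply, Finsupp.finsetSum_apply, altSingle_apply, smul_eq_mul,
    Finset.mul_sum, mul_ite, mul_zero]
  rw [Finset.sum_comm]
  have : ∀ π : Equiv.Perm (Fin n), (∑ t ∈ f.1.support,
      if t ∘ π = s then f.1 t * ((Equiv.Perm.sign π : ℤ) : ℚ) else 0) = f.1 s := by
    intro π
    have hiff : ∀ t : Fin n → V, t ∘ π = s ↔ t = s ∘ π.symm := fun t => by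
      constructor
      · rintro rfl
        ext
        simp
      · rintro rfl
        ext
        simp
    simp only [hiff]
    have h3 : f.1 s = ((Equiv.Perm.sign π : ℤ) : ℚ) * f.1 (s ∘ π.symm) := by
      rw [f.2.2, Equiv.Perm.sign_symm, ← mul_assoc, sign_mul_sign_cast, one_mul]
    rw [Finset.sum_ite_eq', h3, mul_comm]
    simp only [Finsupp.mem_support_iff, ne_eq, ite_not]
    split_ifs with h
    · simp [h]
    · rfl
  simp only [this]
  simp [Fintype.card_perm]

/-- An invariant functional on chains vanishes if every nondegenerate cell has an odd symmetry. -/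
theorem functional_eq_zero {n : ℕ} (φ : S.chain n →ₗ[ℚ] ℚ)
    (hφ : ∀ g f, φ (S.translate n g f) = φ f)
    (hodd : ∀ t : Fin n → V, S.IsCell t → Function.Injective t →
      ∃ (g : G) (π : Equiv.Perm (Fin n)), Equiv.Perm.sign π = -1 ∧ g • t = t ∘ π) : φ = 0 := by
  have h1 : ∀ t (ht : S.IsCell t), Function.Injective t →
      φ ⟨altSingle t, altSingle_mem ht⟩ = 0 := by
    intro t ht hinj
    obtain ⟨g, π, hπ, hg⟩ := hodd t ht hinj
    have h2 : S.translate n g ⟨altSingle t, altSingle_mem ht⟩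
        = (-1 : ℚ) • ⟨altSingle t, altSingle_mem ht⟩ := by
      rw [S.translate_altSingle ht]
      ext1
      simp only [hg, altSingle_comp, hπ, Submodule.coe_smul]
      simp
    have h3 := hφ g ⟨altSingle t, altSingle_mem ht⟩
    rw [h2, map_smul, smul_eq_mul] at h3
    linarith
  ext f
  have h2 : (n.factorial : ℚ) • f = ∑ t ∈ f.1.support.attach,
      f.1 t.1 • (⟨altSingle t.1, altSingle_mem (isCell_of_ne_zero f.2
        (Finsupp.mem_support_iff.1 t.2))⟩ : S.chain n) := by
    apply Subtype.ext
    rw [Submodule.coe_smul, factorial_smul_eq_sum, AddSubmonoidClass.coe_finsetSum,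
      ← Finset.sum_attach]
    rfl
  have h3 := congrArg φ h2
  rw [map_smul, map_sum, Finset.sum_eq_zero] at h3
  · have : (n.factorial : ℚ) ≠ 0 := by exact_mod_cast n.factorial_ne_zero
    simpa [this] using h3
  · rintro ⟨t, ht⟩ -
    have hinj : Function.Injective t := by
      by_contra h
      exact Finsupp.mem_support_iff.1 ht (apply_eq_zero_of_not_injective f.2 h)
    rw [map_smul, h1 t (isCell_of_ne_zero f.2 (Finsupp.mem_support_iff.1 ht)) hinj, smul_zero]

theorem hom_trivial_eq_zero {n : ℕ}
    (hodd : ∀ t : Fin n → V, S.IsCell t → Function.Injective t →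
      ∃ (g : G) (π : Equiv.Perm (Fin n)), Equiv.Perm.sign π = -1 ∧ g • t = t ∘ π)
    (f : S.chainRep n ⟶ Rep.trivial ℚ G ℚ) : f = 0 := by
  have h := S.functional_eq_zero f.hom.toLinearMap (fun g x => Rep.hom_comm_apply f g x) hodd
  ext x
  exact congrArg (fun ψ : S.chain n →ₗ[ℚ] ℚ => ψ x) h

end FrameSystem

namespace FrameSystem

variable {G V : Type} [Group G] [MulAction G V] (S : FrameSystem G V)

theorem ncard_frame (g : G) : (S.frame g).ncard = S.base.card := by
  have h : S.frame g = (fun x => g⁻¹ • x) '' (S.base : Set V) := by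
    ext x
    simp only [mem_frame, Set.mem_image, Finset.mem_coe]
    exact ⟨fun h => ⟨g • x, h, by simp⟩, by rintro ⟨y, hy, rfl⟩; simpa using hy⟩
  rw [h, Set.ncard_image_of_injective _ (MulAction.injective _), Set.ncard_coe_finset]

theorem frame_eq_of_subset {g g' : G} (h : S.frame g ⊆ S.frame g') : S.frame g = S.frame g' :=
  Set.eq_of_subset_of_ncard_le h (by rw [ncard_frame, ncard_frame]) (S.frame_finite g')

/-- A shelling of the frames: `rank` orders the frames, and `free g` consists of those vertices of
`frame g` whose opposite facet leads to a frame of smaller rank, so that a cell of `frame g` has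
`frame g` as its frame of maximal rank exactly when it contains all the vertices outside
`free g`. -/
structure Shelling where
  free : G → Set V
  rank : G → ℕ
  free_subset : ∀ g, free g ⊆ S.frame g
  full_core : ∀ g, S.Full (S.frame g \ free g)
  isMax_iff : ∀ {n : ℕ} (t : Fin n → V) (g : G), S.IsCell t → (∀ j, t j ∈ S.frame g) →
    ((∀ g', (∀ j, t j ∈ S.frame g') → rank g' ≤ rank g) ↔ S.frame g \ free g ⊆ Set.range t)
  frame_eq : ∀ g g', rank g = rank g' → S.frame g = S.frame g'
  frame_eq_of_free_eq_empty : ∀ g g', free g = ∅ → free g' = ∅ → S.frame g = S.frame g'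

namespace Shelling

variable {S} (D : S.Shelling)

/-- A tuple exhausting a frame without free vertices. -/
def IsCritical {n : ℕ} (t : Fin n → V) : Prop :=
  ∃ g, Set.range t = S.frame g ∧ D.free g = ∅

/-- The condition that a tuple lies in `frame g` and contains the core of this frame. -/
def InStar (g : G) {n : ℕ} (t : Fin n → V) : Prop :=
  (∀ j, t j ∈ S.frame g) ∧ S.frame g \ D.free g ⊆ Set.range t

variable {D}

theorem InStar.isCell {g : G} {n : ℕ} {t : Fin n → V} (h : D.InStar g t) : S.IsCell t :=
  ⟨S.full_mono h.2 (D.full_core g), g, h.1⟩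

theorem InStar.rank_le {g g' : G} {n : ℕ} {t : Fin n → V} (h : D.InStar g t)
    (hg' : ∀ j, t j ∈ S.frame g') : D.rank g' ≤ D.rank g :=
  (D.isMax_iff t g h.isCell h.1).2 h.2 g' hg'

theorem inStar_comp_perm_iff {g : G} {n : ℕ} {t : Fin n → V} (π : Equiv.Perm (Fin n)) :
    D.InStar g (t ∘ π) ↔ D.InStar g t := by
  unfold InStar
  rw [EquivLike.range_comp]
  exact and_congr_left fun _ => π.forall_congr_left.trans (by simp)

theorem cons_comp_perm {n : ℕ} (e : V) (t : Fin n → V) (π : Equiv.Perm (Fin n)) :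
    (Fin.cons e (t ∘ π) : Fin (n + 1) → V)
      = (Fin.cons e t : Fin (n + 1) → V) ∘ Equiv.Perm.decomposeFin.symm (0, π) := by
  ext j
  refine Fin.cases ?_ (fun j => ?_) j <;> simp

variable (D)

open Classical in
/-- The contraction of chains towards a vertex `e` of the frame of `g`. -/
noncomputable def cone (g : G) (e : V) {n : ℕ} (F : S.chain (n + 1)) : S.chain n :=
  ⟨Finsupp.onFinset (F.1.support.image Fin.tail)
    (fun t => if D.InStar g t then F.1 (Fin.cons e t) else 0) (fun t ht => by
      simp only [Finset.mem_image, Finsupp.mem_support_iff]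
      exact ⟨Fin.cons e t, fun h => by simp [h] at ht, Fin.tail_cons _ _⟩), by
    refine ⟨fun t ht => ?_, fun t π => ?_⟩
    · by_cases h : D.InStar g t
      · exact h.isCell
      · exact absurd (if_neg h) ht
    · simp only [Finsupp.onFinset_apply, inStar_comp_perm_iff]
      split_ifs
      · rw [cons_comp_perm, F.2.2]
        simp
      · simp⟩

variable {D}

theorem cone_apply {g : G} {e : V} {n : ℕ} {F : S.chain (n + 1)} {t : Fin n → V}
    (h : D.InStar g t) : (D.cone g e F).1 t = F.1 (Fin.cons e t) := if_pos h

theorem cone_apply_eq_zero {g : G} {e : V} {n : ℕ} {F : S.chain (n + 1)} {t : Fin n → V}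
    (h : ¬ D.InStar g t) : (D.cone g e F).1 t = 0 := if_neg h

theorem cons_apply_succAbove {n : ℕ} (t : Fin (n + 1) → V) (i : Fin (n + 1)) :
    (Fin.cons (t i) (t ∘ i.succAbove) : Fin (n + 1) → V) = t ∘ i.cycleRange.symm := by
  ext j
  refine Fin.cases ?_ (fun j => ?_) j <;> simp

theorem faceSum_cons {n : ℕ} (f : (Fin (n + 1) → V) → ℚ) (e : V) (t : Fin (n + 1) → V) :
    faceSum f (Fin.cons e t : Fin (n + 2) → V)
      = f t - ∑ i : Fin (n + 1), (-1) ^ (i : ℕ) * f (Fin.cons e (t ∘ i.succAbove)) := by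
  rw [faceSum, Fin.sum_univ_succ, sub_eq_add_neg, ← Finset.sum_neg_distrib]
  congr 1
  · simp only [Fin.val_zero, pow_zero, one_mul]
    congr 1
  · refine Finset.sum_congr rfl fun i _ => ?_
    have : (Fin.cons e t : Fin (n + 2) → V) ∘ i.succ.succAbove
        = Fin.cons e (t ∘ i.succAbove) := by
      ext j
      refine Fin.cases ?_ (fun j => ?_) j <;> simp
    rw [this, Fin.val_succ, pow_succ]
    ring

theorem eq_differential_cone {g : G} {e : V} (he : e ∈ D.free g) {n : ℕ} {F : S.chain (n + 1)}
    (hF : S.differential (n + 1) F = 0)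
    (hsupp : ∀ t, F.1 t ≠ 0 → D.IsCritical t ∨
      ∀ g', (∀ j, t j ∈ S.frame g') → D.rank g' ≤ D.rank g)
    {t : Fin (n + 1) → V} (ht : D.InStar g t) :
    F.1 t = (S.differential n (D.cone g e F)).1 t := by
  have heg := D.free_subset g he
  by_cases hinj : Function.Injective t
  swap
  · rw [apply_eq_zero_of_not_injective F.2 hinj,
      apply_eq_zero_of_not_injective (S.differential n _).2 hinj]
  rw [S.differential_apply _ ht.1, faceSum]
  by_cases hmem : e ∈ Set.range t
  · obtain ⟨i, rfl⟩ := hmem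
    rw [Finset.sum_eq_single i]
    · have hs : D.InStar g (t ∘ i.succAbove) := by
        refine ⟨fun j => ht.1 _, fun x hx => ?_⟩
        obtain ⟨k, rfl⟩ := ht.2 hx
        obtain ⟨j, rfl⟩ : ∃ j, i.succAbove j = k :=
          Fin.exists_succAbove_eq fun h => hx.2 (h ▸ he)
        exact ⟨j, rfl⟩
      rw [cone_apply hs, cons_apply_succAbove, F.2.2, Equiv.Perm.sign_symm, Fin.sign_cycleRange]
      push_cast
      rw [← mul_assoc, ← mul_pow]
      simp
    · intro k _ hk
      by_cases hs : D.InStar g (t ∘ k.succAbove)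
      · rw [cone_apply hs, apply_eq_zero_of_not_injective F.2, mul_zero]
        obtain ⟨j, hj⟩ := Fin.exists_succAbove_eq hk.symm
        intro hc
        have : (0 : Fin (n + 1)) = j.succ := hc (by simp [hj])
        exact Fin.succ_ne_zero j this.symm
      · rw [cone_apply_eq_zero hs, mul_zero]
    · simp
  · have hcons : ∀ j, (Fin.cons e t : Fin (n + 2) → V) j ∈ S.frame g := fun j => by
      refine Fin.cases ?_ (fun j => ?_) j
      · simpa using heg
      · simpa using ht.1 j
    have h0 := S.differential_apply F hcons
    rw [hF, faceSum_cons] at h0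
    have h1 : F.1 t = ∑ i : Fin (n + 1), (-1) ^ (i : ℕ) * F.1 (Fin.cons e (t ∘ i.succAbove)) := by
      simpa using (sub_eq_zero.1 h0.symm)
    rw [h1]
    refine Finset.sum_congr rfl fun i _ => ?_
    congr 1
    by_cases hs : D.InStar g (t ∘ i.succAbove)
    · rw [cone_apply hs]
    · rw [cone_apply_eq_zero hs]
      by_contra hne
      have hin : ∀ j, (Fin.cons e (t ∘ i.succAbove) : Fin (n + 1) → V) j ∈ S.frame g := fun j => by
        refine Fin.cases ?_ (fun j => ?_) j
        · simpa using heg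
        · simpa using ht.1 _
      have hcore : S.frame g \ D.free g
          ⊆ Set.range (Fin.cons e (t ∘ i.succAbove) : Fin (n + 1) → V) := by
        rcases hsupp _ hne with ⟨g', hg', -⟩ | hmax
        · rw [hg', S.frame_eq_of_subset (g := g') (g' := g)]
          · exact Set.sdiff_subset
          · rw [← hg']
            rintro _ ⟨j, rfl⟩
            exact hin j
        · exact (D.isMax_iff _ g (isCell_of_ne_zero F.2 hne) hin).1 hmax
      refine hs ⟨fun j => ht.1 _, fun x hx => ?_⟩
      have hx' := hcore hx
      rw [Fin.range_cons] at hx'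
      rcases hx' with rfl | hx'
      · exact absurd he hx.2
      · exact hx'

theorem exists_reduction {n : ℕ} (N : ℕ) (F : S.chain (n + 1))
    (hF : S.differential (n + 1) F = 0)
    (hsupp : ∀ t, F.1 t ≠ 0 → D.IsCritical t ∨ ∀ g, (∀ j, t j ∈ S.frame g) → D.rank g < N) :
    ∃ H : S.chain n, ∀ t, (F - S.differential n H).1 t ≠ 0 → D.IsCritical t := by
  induction N generalizing F with
  | zero =>
    refine ⟨0, fun t ht => ?_⟩
    rw [map_zero, sub_zero] at ht
    rcases hsupp t ht with h | h
    · exact h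
    · obtain ⟨-, g, hg⟩ := isCell_of_ne_zero F.2 ht
      exact absurd (h g hg) (Nat.not_lt_zero _)
  | succ N ih =>
    by_cases hN : ∃ g, D.rank g = N
    swap
    · refine ih F hF fun t ht => (hsupp t ht).imp_right fun h g hg => ?_
      exact lt_of_le_of_ne (Nat.lt_succ_iff.1 (h g hg)) fun h' => hN ⟨g, h'⟩
    obtain ⟨g, rfl⟩ := hN
    have hmax : ∀ t, F.1 t ≠ 0 → D.IsCritical t ∨
        ∀ g', (∀ j, t j ∈ S.frame g') → D.rank g' ≤ D.rank g := fun t ht =>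
      (hsupp t ht).imp_right fun h g' hg' => Nat.lt_succ_iff.1 (h g' hg')
    have hlt : ∀ {t : Fin (n + 1) → V}, (¬ ∀ j, t j ∈ S.frame g) → ∀ g', (∀ j, t j ∈ S.frame g') →
        D.rank g' ≤ D.rank g → D.rank g' < D.rank g := fun ht g' hg' hle =>
      lt_of_le_of_ne hle fun h => ht (D.frame_eq _ _ h ▸ hg')
    rcases (D.free g).eq_empty_or_nonempty with hfree | ⟨e, he⟩
    · refine ih F hF fun t ht => ?_
      rcases hmax t ht with h | h
      · exact Or.inl h
      by_cases htg : ∀ j, t j ∈ S.frame g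
      · have h1 := (D.isMax_iff t g (isCell_of_ne_zero F.2 ht) htg).1 h
        rw [hfree, Set.sdiff_empty] at h1
        refine Or.inl ⟨g, h1.antisymm' ?_, hfree⟩
        rintro _ ⟨j, rfl⟩
        exact htg j
      · exact Or.inr fun g' hg' => hlt htg g' hg' (h g' hg')
    · have hF' : S.differential (n + 1) (F - S.differential n (D.cone g e F)) = 0 := by
        rw [map_sub, hF, differential_differential, sub_zero]
      suffices hs : ∀ t, (F - S.differential n (D.cone g e F)).1 t ≠ 0 → D.IsCritical t ∨
          ∀ g', (∀ j, t j ∈ S.frame g') → D.rank g' < D.rank g by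
        obtain ⟨H, hH⟩ := ih _ hF' hs
        refine ⟨D.cone g e F + H, fun t ht => hH t ?_⟩
        rwa [map_add, ← sub_sub] at ht
      intro t ht
      change F.1 t - (S.differential n (D.cone g e F)).1 t ≠ 0 at ht
      by_cases hstar : D.InStar g t
      · rw [eq_differential_cone he hF hmax hstar, sub_self] at ht
        exact absurd rfl ht
      by_cases hd : (S.differential n (D.cone g e F)).1 t = 0
      · rw [hd, sub_zero] at ht
        rcases hmax t ht with h | h
        · exact Or.inl h
        by_cases htg : ∀ j, t j ∈ S.frame g
        · exact absurd ⟨htg, (D.isMax_iff t g (isCell_of_ne_zero F.2 ht) htg).1 h⟩ hstar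
        · exact Or.inr fun g' hg' => hlt htg g' hg' (h g' hg')
      · rw [S.differential_apply_of_isCell _ (isCell_of_ne_zero (S.differential n _).2 hd)] at hd
        obtain ⟨i, -, hi⟩ := Finset.exists_ne_zero_of_sum_ne_zero hd
        have hface : D.InStar g (t ∘ i.succAbove) := by
          by_contra h
          rw [cone_apply_eq_zero h, mul_zero] at hi
          exact hi rfl
        have htg : ¬ ∀ j, t j ∈ S.frame g := fun h =>
          hstar ⟨h, hface.2.trans (range_succAbove_subset t i)⟩
        exact Or.inr fun g' hg' => hlt htg g' hg' (hface.rank_le fun j => hg' _)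

variable (D)

theorem exists_bound {n : ℕ} (F : S.chain n) :
    ∃ N, ∀ t, F.1 t ≠ 0 → ∀ g, (∀ j, t j ∈ S.frame g) → D.rank g < N := by
  have hfin : (⋃ t ∈ (F.1.support : Set (Fin n → V)), S.carriers t).Finite :=
    F.1.support.finite_toSet.biUnion fun t ht =>
      (isCell_of_ne_zero F.2 (by simpa using ht)).carriers_finite
  obtain ⟨N, hN⟩ := (hfin.image D.rank).bddAbove
  refine ⟨N + 1, fun t ht g hg => Nat.lt_succ_iff.2 (hN ⟨g, ?_, rfl⟩)⟩
  simp only [Set.mem_iUnion]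
  exact ⟨t, by simpa using ht, hg⟩

theorem exists_differential_sub {n : ℕ} (F : S.chain (n + 1))
    (hF : S.differential (n + 1) F = 0) :
    ∃ H : S.chain n, ∀ t, (F - S.differential n H).1 t ≠ 0 → D.IsCritical t := by
  obtain ⟨N, hN⟩ := D.exists_bound F
  exact exists_reduction N F hF fun t ht => Or.inr (hN t ht)

theorem exists_differential_eq (D : S.Shelling) {n : ℕ} (hn : n + 1 < S.base.card)
    (F : S.chain (n + 1))
    (hF : S.differential (n + 1) F = 0) : ∃ H : S.chain n, S.differential n H = F := by
  obtain ⟨H, hH⟩ := D.exists_differential_sub F hF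
  refine ⟨H, (sub_eq_zero.1 ?_).symm⟩
  ext t
  by_contra h
  obtain ⟨g, hg, -⟩ := hH t h
  have h1 := S.ncard_frame g
  rw [← hg, ← Set.image_univ] at h1
  have h2 := Set.ncard_image_le (f := t) (s := Set.univ) Set.finite_univ
  rw [h1, Set.ncard_univ, Nat.card_fin] at h2
  omega

theorem chain_eq_zero_of_card_lt {n : ℕ} (hn : S.base.card < n) (F : S.chain n) : F = 0 := by
  ext t
  by_contra h
  obtain ⟨-, g, hg⟩ := isCell_of_ne_zero F.2 h
  have hinj : Function.Injective t := by
    by_contra h'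
    exact h (apply_eq_zero_of_not_injective F.2 h')
  have h1 : Set.range t ⊆ S.frame g := by
    rintro _ ⟨j, rfl⟩
    exact hg j
  have h2 := Set.ncard_le_ncard h1 (S.frame_finite g)
  rw [ncard_frame, ← Set.image_univ, Set.ncard_image_of_injective _ hinj, Set.ncard_univ,
    Nat.card_fin] at h2
  omega

/-- The pairing of chains with an orientation character. -/
noncomputable def pairing (S : FrameSystem G V) {n : ℕ} (o : (Fin n → V) → ℚ) :
    S.chain n →ₗ[ℚ] ℚ :=
  Finsupp.lsum ℚ (fun t => LinearMap.mul ℚ ℚ (o t)) ∘ₗ (S.chain n).subtype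

theorem pairing_apply {n : ℕ} (o : (Fin n → V) → ℚ) (F : S.chain n) :
    pairing S o F = ∑ t ∈ F.1.support, o t * F.1 t := rfl

theorem exists_differential_eq_of_pairing (D : S.Shelling) {n : ℕ} (hn : S.base.card = n + 1)
    {o : (Fin (n + 1) → V) → ℚ}
    (ho : ∀ t (π : Equiv.Perm (Fin (n + 1))), o (t ∘ π) = (Equiv.Perm.sign π : ℤ) * o t)
    (hone : ∀ t g, Function.Injective t → Set.range t = S.frame g → o t ≠ 0)
    (hod : ∀ H : S.chain n, pairing S o (S.differential n H) = 0)
    (F : S.chain (n + 1)) (hF : pairing S o F = 0) : ∃ H : S.chain n, S.differential n H = F := by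
  obtain ⟨H, hH⟩ := D.exists_differential_sub F
    (chain_eq_zero_of_card_lt (by omega) _)
  have hp : pairing S o (F - S.differential n H) = 0 := by rw [map_sub, hF, hod, sub_zero]
  set E := F - S.differential n H with hE
  refine ⟨H, (sub_eq_zero.1 ?_).symm⟩
  rw [← hE]
  by_contra hne
  obtain ⟨t, ht⟩ : ∃ t, E.1 t ≠ 0 := by
    by_contra! h
    exact hne (Subtype.ext (Finsupp.ext h))
  have hinj : ∀ s, E.1 s ≠ 0 → Function.Injective s := fun s hs => by
    by_contra h
    exact hs (apply_eq_zero_of_not_injective E.2 h)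
  obtain ⟨g, hg, hfree⟩ := hH t ht
  have hconst : ∀ s ∈ E.1.support, o s * E.1 s = o t * E.1 t := by
    intro s hs
    have hs' := Finsupp.mem_support_iff.1 hs
    obtain ⟨g', hg', hfree'⟩ := hH s hs'
    have hrange : Set.range s = Set.range t := by
      rw [hg, hg', D.frame_eq_of_free_eq_empty g' g hfree' hfree]
    have hex : ∀ j, ∃ k, t k = s j := fun j => hrange.subset ⟨j, rfl⟩
    choose σ hσ using hex
    have hσinj : Function.Injective σ := fun a b hab => hinj s hs' (by rw [← hσ, ← hσ, hab])
    let π : Equiv.Perm (Fin (n + 1)) :=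
      Equiv.ofBijective σ (Finite.injective_iff_bijective.1 hσinj)
    have hst : s = t ∘ π := funext fun j => (hσ j).symm
    rw [hst, ho, E.2.2]
    linear_combination (o t * E.1 t) * sign_mul_sign_cast π
  rw [pairing_apply, Finset.sum_congr rfl hconst, Finset.sum_const, nsmul_eq_mul] at hp
  have hcard : (E.1.support.card : ℚ) ≠ 0 := by
    exact_mod_cast (Finset.card_pos.2 ⟨t, Finsupp.mem_support_iff.2 ht⟩).ne'
  exact mul_ne_zero hcard (mul_ne_zero (hone t g (hinj t ht) hg) ht) hp

end Shelling

end FrameSystem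

namespace FrameSystem

variable {G V : Type} [Group G] [MulAction G V] (S : FrameSystem G V)

/-- The differential as a morphism of representations. -/
noncomputable def differentialHom (n : ℕ) : S.chainRep n ⟶ S.chainRep (n + 1) :=
  Rep.ofHom ⟨S.differential n, fun g => by ext1 f; exact S.differential_translate g f⟩

theorem pairing_altSingle {n : ℕ} {o : (Fin n → V) → ℚ}
    (ho : ∀ t (π : Equiv.Perm (Fin n)), o (t ∘ π) = (Equiv.Perm.sign π : ℤ) * o t)
    {t : Fin n → V} (ht : S.IsCell t) :
    Shelling.pairing S o ⟨altSingle t, altSingle_mem ht⟩ = n.factorial * o t := by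
  change Finsupp.lsum ℚ (fun t => LinearMap.mul ℚ ℚ (o t)) (altSingle t) = _
  rw [altSingle, map_sum]
  have : ∀ π : Equiv.Perm (Fin n), Finsupp.lsum ℚ (fun t => LinearMap.mul ℚ ℚ (o t))
      (Finsupp.single (t ∘ π) ((Equiv.Perm.sign π : ℤ) : ℚ)) = o t := by
    intro π
    rw [Finsupp.lsum_single, LinearMap.mul_apply_apply, ho]
    linear_combination o t * sign_mul_sign_cast π
  simp [this, Fintype.card_perm]

theorem pairing_translate {n : ℕ} {o : (Fin n → V) → ℚ} (hinv : ∀ (g : G) t, o (g • t) = o t)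
    (g : G) (F : S.chain n) :
    Shelling.pairing S o (S.translate n g F) = Shelling.pairing S o F := by
  rw [Shelling.pairing_apply, Shelling.pairing_apply]
  refine Finset.sum_bij' (fun t _ => g⁻¹ • t) (fun t _ => g • t) ?_ ?_ ?_ ?_ ?_
  · intro t ht
    simpa [translate_apply] using ht
  · intro t ht
    simpa [translate_apply] using ht
  · simp
  · simp
  · intro t _
    rw [hinv, translate_apply]

/-- A six-vertex frame system with a shelling, odd symmetries of all proper cells and an invariant
orientation of the frames computes the cohomology of a point. -/
theorem subsingleton_groupCohomology (D : S.Shelling) (hcard : S.base.card = 6)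
    (hsmall : ∀ n < 3, ∀ t : Fin n → V, ¬ S.IsCell t)
    (hodd : ∀ n < 6, ∀ t : Fin n → V, S.IsCell t → Function.Injective t →
      ∃ (g : G) (π : Equiv.Perm (Fin n)), Equiv.Perm.sign π = -1 ∧ g • t = t ∘ π)
    {o : (Fin 6 → V) → ℚ}
    (ho : ∀ t (π : Equiv.Perm (Fin 6)), o (t ∘ π) = (Equiv.Perm.sign π : ℤ) * o t)
    (hone : ∀ t g, Function.Injective t → Set.range t = S.frame g → o t ≠ 0)
    (hinv : ∀ (g : G) t, o (g • t) = o t) (k : ℕ) (hk : 1 ≤ k) :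
    Subsingleton (groupCohomology (Rep.trivial ℚ G ℚ) k) := by
  have hzero : ∀ n < 3, ∀ F : S.chain n, F = 0 := fun n hn F => by
    ext t
    exact apply_eq_zero F.2 (hsmall n hn t)
  let ε : S.chainRep 6 ⟶ Rep.trivial ℚ G ℚ :=
    Rep.ofHom ⟨Shelling.pairing S o, fun g => by
      ext1 F
      exact S.pairing_translate hinv g F⟩
  have hod : ∀ H : S.chain 5, Shelling.pairing S o (S.differential 5 H) = 0 := by
    have := S.functional_eq_zero (Shelling.pairing S o ∘ₗ S.differential 5) (fun g F => by
      rw [LinearMap.comp_apply, LinearMap.comp_apply, differential_translate,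
        pairing_translate S hinv]) (hodd 5 (by norm_num))
    exact fun H => congrArg (fun ψ : S.chain 5 →ₗ[ℚ] ℚ => ψ H) this
  let P : ℕ → Rep.{0} ℚ G
    | 0 => S.chainRep 6
    | 1 => S.chainRep 5
    | 2 => S.chainRep 4
    | 3 => S.chainRep 3
    | _ + 4 => S.chainRep 0
  let d : ∀ n, P (n + 1) ⟶ P n
    | 0 => S.differentialHom 5
    | 1 => S.differentialHom 4
    | 2 => S.differentialHom 3
    | 3 => 0
    | _ + 4 => 0
  refine groupCohomology.subsingleton_of_resolution P d ε ?_ ?_ hod ?_ ?_ ?_ _ ?_ k hk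
  · rintro (_ | _ | _ | _ | n) <;> exact S.projective_chainRep _
  · rintro (_ | _ | _ | _ | n) x
    · exact S.differential_differential x
    · exact S.differential_differential x
    · exact map_zero (S.differential 3)
    · rfl
    · rfl
  · let t : Fin 6 → V := fun j => (S.base.equivFinOfCardEq hcard).symm j
    have hinj : Function.Injective t :=
      Subtype.val_injective.comp (S.base.equivFinOfCardEq hcard).symm.injective
    have hrange : Set.range t = S.frame 1 := by
      ext x
      rw [mem_frame, one_smul]
      constructor
      · rintro ⟨j, rfl⟩
        exact ((S.base.equivFinOfCardEq hcard).symm j).2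
      · intro hx
        exact ⟨S.base.equivFinOfCardEq hcard ⟨x, hx⟩, by simp [t]⟩
    have hcell : S.IsCell t :=
      ⟨hrange ▸ S.full_mono Set.sdiff_subset (D.full_core 1), 1, fun j => hrange ▸ ⟨j, rfl⟩⟩
    have hot := hone t 1 hinj hrange
    have hfac : ((6).factorial : ℚ) ≠ 0 := by exact_mod_cast (6).factorial_ne_zero
    intro c
    refine ⟨(c / ((6).factorial * o t)) • (⟨altSingle t, altSingle_mem hcell⟩ : S.chain 6), ?_⟩
    change Shelling.pairing S o (_ • _) = c
    rw [map_smul, S.pairing_altSingle ho hcell, smul_eq_mul,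
      div_mul_cancel₀ _ (mul_ne_zero hfac hot)]
  · exact fun F hF => D.exists_differential_eq_of_pairing hcard ho hone hod F hF
  · rintro (_ | _ | _ | _ | n) (x : S.chain _) hx
    · exact D.exists_differential_eq (n := 4) (by omega) x hx
    · exact D.exists_differential_eq (n := 3) (by omega) x hx
    · obtain ⟨H, rfl⟩ := D.exists_differential_eq (n := 2) (by omega) x hx
      rw [hzero 2 (by norm_num) H]
      exact ⟨0, (map_zero (S.differential 2)).symm⟩
    · exact ⟨0, (hzero 0 (by norm_num) x).symm⟩
    · exact ⟨0, (hzero 0 (by norm_num) x).symm⟩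
  · rintro (_ | _ | _ | n) f
    · exact S.hom_trivial_eq_zero (hodd 5 (by norm_num)) f
    · exact S.hom_trivial_eq_zero (hodd 4 (by norm_num)) f
    · exact S.hom_trivial_eq_zero (hodd 3 (by norm_num)) f
    · exact S.hom_trivial_eq_zero (hodd 0 (by norm_num)) f

end FrameSystem

open Matrix

/-- Integral `3 × 3` matrices, with `SL₃(ℤ)` acting by change of variables `X ↦ g X gᵀ`. -/
@[ext]
structure Form where
  /-- The underlying matrix. -/
  mat : Matrix (Fin 3) (Fin 3) ℤ

namespace Form

instance : DecidableEq Form := fun X Y => decidable_of_iff (X.mat = Y.mat) Form.ext_iff.symm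

instance : MulAction (SpecialLinearGroup (Fin 3) ℤ) Form where
  smul g X := ⟨g.1 * X.mat * g.1ᵀ⟩
  one_smul X := by
    ext1
    change (1 : Matrix (Fin 3) (Fin 3) ℤ) * _ * 1ᵀ = _
    simp
  mul_smul g h X := by
    ext1
    change (g.1 * h.1) * _ * (g.1 * h.1)ᵀ = g.1 * (h.1 * _ * h.1ᵀ) * g.1ᵀ
    simp [Matrix.mul_assoc]

theorem inv_mul_val (g : SpecialLinearGroup (Fin 3) ℤ) : (g⁻¹).1 * g.1 = 1 :=
  congrArg Subtype.val (inv_mul_cancel g)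

theorem mul_inv_val (g : SpecialLinearGroup (Fin 3) ℤ) : g.1 * (g⁻¹).1 = 1 :=
  congrArg Subtype.val (mul_inv_cancel g)

/-- The rank one matrix `u uᵀ`. -/
def sq (u : Fin 3 → ℤ) : Form := ⟨vecMulVec u u⟩

theorem smul_mat (g : SpecialLinearGroup (Fin 3) ℤ) (X : Form) :
    (g • X).mat = g.1 * X.mat * g.1ᵀ := rfl

theorem smul_sq (g : SpecialLinearGroup (Fin 3) ℤ) (u : Fin 3 → ℤ) :
    g • sq u = sq (g.1 *ᵥ u) := by
  ext1
  rw [smul_mat, sq, sq, mul_vecMulVec, vecMulVec_mul, vecMul_transpose]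

/-- The value of the quadratic form with matrix `A` at `u`. -/
def qf (A : Matrix (Fin 3) (Fin 3) ℤ) (u : Fin 3 → ℤ) : ℤ := u ⬝ᵥ A *ᵥ u

theorem qf_congr (g A : Matrix (Fin 3) (Fin 3) ℤ) (u : Fin 3 → ℤ) :
    qf (gᵀ * A * g) u = qf A (g *ᵥ u) := by
  rw [qf, qf, ← mulVec_mulVec, ← mulVec_mulVec, dotProduct_mulVec, vecMul_transpose]

theorem qf_sq (u w : Fin 3 → ℤ) : qf (sq u).mat w = (w ⬝ᵥ u) ^ 2 := by
  rw [qf, sq, vecMulVec_mulVec, pow_two, dotProduct_smul, MulOpposite.smul_eq_mul_unop,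
    MulOpposite.unop_op, dotProduct_comm u w]

/-- The minimal vectors, up to sign, of the perfect form `A₃`. -/
def root : Fin 6 → Fin 3 → ℤ :=
  ![![1, 0, 0], ![0, 1, 0], ![0, 0, 1], ![1, -1, 0], ![0, 1, -1], ![1, 0, -1]]

/-- The perfect form `A₃`. -/
def perfect : Matrix (Fin 3) (Fin 3) ℤ := !![2, 1, 1; 1, 2, 1; 1, 1, 2]

theorem qf_perfect (u : Fin 3 → ℤ) :
    qf perfect u = (u 0 + u 1 + u 2) ^ 2 + u 0 ^ 2 + u 1 ^ 2 + u 2 ^ 2 := by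
  simp [qf, perfect, dotProduct, mulVec, Fin.sum_univ_three]
  ring

theorem sq_root_injective : Function.Injective fun i => sq (root i) := by decide

theorem sq_eq_sq_iff_of_small :
    ∀ a ∈ ({-1, 0, 1} : Finset ℤ), ∀ b ∈ ({-1, 0, 1} : Finset ℤ), ∀ c ∈ ({-1, 0, 1} : Finset ℤ),
      (a + b + c) ^ 2 + a ^ 2 + b ^ 2 + c ^ 2 ≤ 2 → ![a, b, c] ≠ 0 →
      (a + b + c) ^ 2 + a ^ 2 + b ^ 2 + c ^ 2 = 2 ∧ ∃ i, sq ![a, b, c] = sq (root i) := by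
  decide

theorem qf_perfect_root (i : Fin 6) : qf perfect (root i) = 2 := by
  revert i; decide

theorem qf_perfect_le_two {u : Fin 3 → ℤ} (hu : u ≠ 0) (h : qf perfect u ≤ 2) :
    qf perfect u = 2 ∧ ∃ i, sq u = sq (root i) := by
  rw [qf_perfect] at h ⊢
  have hmem : ∀ j, u j ∈ ({-1, 0, 1} : Finset ℤ) := by
    have key : ∀ x : ℤ, x ^ 2 ≤ 2 → x ∈ ({-1, 0, 1} : Finset ℤ) := fun x hx => by
      have h1 : -1 ≤ x := by nlinarith
      have h2 : x ≤ 1 := by nlinarith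
      simp only [Finset.mem_insert, Finset.mem_singleton]
      omega
    intro j
    apply key
    fin_cases j <;> simp only [Fin.zero_eta, Fin.mk_one, Fin.reduceFinMk] <;>
      nlinarith [sq_nonneg (u 0 + u 1 + u 2), sq_nonneg (u 0), sq_nonneg (u 1), sq_nonneg (u 2)]
  have hu' : u = ![u 0, u 1, u 2] := by ext j; fin_cases j <;> rfl
  have := sq_eq_sq_iff_of_small _ (hmem 0) _ (hmem 1) _ (hmem 2) h (hu' ▸ hu)
  rwa [← hu'] at this

theorem two_le_qf_perfect {u : Fin 3 → ℤ} (hu : u ≠ 0) : 2 ≤ qf perfect u := by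
  by_contra h
  have := (qf_perfect_le_two hu (by omega)).1
  omega

theorem qf_eq_of_sq_eq {u v : Fin 3 → ℤ} (h : sq u = sq v) (A : Matrix (Fin 3) (Fin 3) ℤ) :
    qf A u = qf A v := by
  have key : ∀ w : Fin 3 → ℤ, qf A w = (A * (sq w).mat).trace := fun w => by
    rw [sq, mul_vecMulVec, trace_vecMulVec, qf, dotProduct_comm]
  rw [key, key, h]

/-- Fullness of a set of matrices: it annihilates no nonzero vector. -/
def Full (S : Set Form) : Prop :=
  ∀ w : Fin 3 → ℤ, (∀ X ∈ S, qf X.mat w = 0) → w = 0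

theorem mulVec_eq_zero_iff (g : SpecialLinearGroup (Fin 3) ℤ) (w : Fin 3 → ℤ) :
    g.1 *ᵥ w = 0 ↔ w = 0 := by
  refine ⟨fun h => ?_, fun h => by rw [h, mulVec_zero]⟩
  have : (g⁻¹).1 *ᵥ (g.1 *ᵥ w) = w := by
    rw [mulVec_mulVec, inv_mul_val, one_mulVec]
  rw [← this, h, mulVec_zero]

theorem full_smul (g : SpecialLinearGroup (Fin 3) ℤ) {n : ℕ} (t : Fin n → Form)
    (h : Full (Set.range t)) : Full (Set.range (g • t)) := by
  intro w hw
  have h1 : g.1ᵀ *ᵥ w = 0 := by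
    apply h
    rintro _ ⟨j, rfl⟩
    rw [← qf_congr, transpose_transpose]
    exact hw _ ⟨j, rfl⟩
  exact (mulVec_eq_zero_iff g.transpose w).1 h1

/-- The vertices of the base frame. -/
def base : Finset Form := Finset.univ.image fun i => sq (root i)

theorem mem_base {X : Form} : X ∈ base ↔ ∃ i, X = sq (root i) := by
  simp [base, eq_comm]

theorem sq_apply_self_le {X : Form} (h : X ∈ base) (a : Fin 3) :
    X.mat a a ≤ 1 := by
  obtain ⟨i, rfl⟩ := mem_base.1 h
  revert i a
  decide

theorem eq_sq_of_smul_mem_base {g : SpecialLinearGroup (Fin 3) ℤ} {X : Form} (h : g • X ∈ base) :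
    ∃ i, X = sq ((g⁻¹).1 *ᵥ root i) := by
  obtain ⟨i, hi⟩ := mem_base.1 h
  exact ⟨i, by rw [← smul_sq, ← hi, inv_smul_smul]⟩

theorem finite_carriers {n : ℕ} (t : Fin n → Form) (ht : Full (Set.range t)) :
    {g : SpecialLinearGroup (Fin 3) ℤ | ∀ j, g • t j ∈ base}.Finite := by
  rcases Set.eq_empty_or_nonempty
    {g : SpecialLinearGroup (Fin 3) ℤ | ∀ j, g • t j ∈ base} with h | ⟨g₀, hg₀⟩
  · rw [h]; exact Set.finite_empty
  have hv : ∀ j, ∃ v, t j = sq v := fun j =>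
    let ⟨_, hi⟩ := eq_sq_of_smul_mem_base (hg₀ j)
    ⟨_, hi⟩
  choose v hv using hv
  have hfin : (Set.univ.pi fun _ : Fin 3 => Set.univ.pi fun _ : Fin n =>
      Set.Icc (-1 : ℤ) 1).Finite :=
    Set.Finite.pi fun _ => Set.Finite.pi fun _ => Set.finite_Icc _ _
  refine Set.Finite.of_finite_image (f := fun g a j => (g.1 *ᵥ v j) a)
    (hfin.subset ?_) fun g _ g' _ h => ?_
  · rintro _ ⟨g, hg, rfl⟩ a - j -
    have h1 := sq_apply_self_le (hg j) a
    rw [hv j, smul_sq] at h1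
    have h2 : (g.1 *ᵥ v j) a * (g.1 *ᵥ v j) a ≤ 1 := h1
    exact ⟨by nlinarith, by nlinarith⟩
  · ext a b
    have h1 : g.1 a - g'.1 a = 0 := by
      apply ht
      rintro _ ⟨j, rfl⟩
      rw [hv j, qf_sq, sub_dotProduct]
      have h2 := congrFun (congrFun h a) j
      have h3 : g.1 a ⬝ᵥ v j = g'.1 a ⬝ᵥ v j := h2
      rw [h3, sub_self]
      rfl
    exact congrFun (sub_eq_zero.1 h1) b

/-- The Voronoi tessellation of the cone of ternary quadratic forms. -/
def system : FrameSystem (SpecialLinearGroup (Fin 3) ℤ) Form where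
  base := base
  Full := Full
  full_mono h hS w hw := hS w fun X hX => hw X (h hX)
  full_smul := full_smul
  proper := finite_carriers

/-- The vectors whose squares are the vertices of the frame of `g`. -/
def vec (g : SpecialLinearGroup (Fin 3) ℤ) (i : Fin 6) : Fin 3 → ℤ := (g⁻¹).1 *ᵥ root i

theorem mulVec_vec (g : SpecialLinearGroup (Fin 3) ℤ) (i : Fin 6) : g.1 *ᵥ vec g i = root i := by
  rw [vec, mulVec_mulVec, mul_inv_val, one_mulVec]

theorem smul_sq_vec (g : SpecialLinearGroup (Fin 3) ℤ) (i : Fin 6) :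
    g • sq (vec g i) = sq (root i) := by
  rw [smul_sq, mulVec_vec]

theorem mem_frame_iff {g : SpecialLinearGroup (Fin 3) ℤ} {X : Form} :
    X ∈ system.frame g ↔ ∃ i, X = sq (vec g i) :=
  ⟨eq_sq_of_smul_mem_base, by
    rintro ⟨i, rfl⟩
    exact mem_base.2 ⟨i, smul_sq_vec g i⟩⟩

theorem sq_vec_injective (g : SpecialLinearGroup (Fin 3) ℤ) :
    Function.Injective fun i => sq (vec g i) := fun i j h =>
  sq_root_injective (by
    have h' := congrArg (g • ·) h
    simpa only [smul_sq_vec] using h')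

theorem root_ne_zero (i : Fin 6) : root i ≠ 0 := by revert i; decide

theorem vec_ne_zero (g : SpecialLinearGroup (Fin 3) ℤ) (i : Fin 6) : vec g i ≠ 0 :=
  (mulVec_eq_zero_iff g⁻¹ _).not.2 (root_ne_zero i)

/-- The perfect form attached to the frame of `g`. -/
def form (g : SpecialLinearGroup (Fin 3) ℤ) : Matrix (Fin 3) (Fin 3) ℤ := g.1ᵀ * perfect * g.1

theorem two_le_qf_form (g : SpecialLinearGroup (Fin 3) ℤ) {u : Fin 3 → ℤ} (hu : u ≠ 0) :
    2 ≤ qf (form g) u := by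
  rw [form, qf_congr]
  exact two_le_qf_perfect ((mulVec_eq_zero_iff g u).not.2 hu)

theorem qf_form_eq_two_iff (g : SpecialLinearGroup (Fin 3) ℤ) {u : Fin 3 → ℤ} (hu : u ≠ 0) :
    qf (form g) u = 2 ↔ sq u ∈ system.frame g := by
  rw [form, qf_congr]
  constructor
  · intro h
    obtain ⟨-, hi⟩ := qf_perfect_le_two ((mulVec_eq_zero_iff g u).not.2 hu) h.le
    rw [FrameSystem.mem_frame, smul_sq]
    exact mem_base.2 hi
  · intro h
    rw [FrameSystem.mem_frame, smul_sq] at h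
    obtain ⟨i, hi⟩ := mem_base.1 h
    rw [qf_eq_of_sq_eq hi, qf_perfect_root]

theorem qf_form_vec (g : SpecialLinearGroup (Fin 3) ℤ) (i : Fin 6) : qf (form g) (vec g i) = 2 :=
  (qf_form_eq_two_iff g (vec_ne_zero g i)).2 (mem_frame_iff.2 ⟨i, rfl⟩)

theorem perfect_isSymm : perfect.IsSymm := by decide

theorem form_isSymm (g : SpecialLinearGroup (Fin 3) ℤ) : (form g).IsSymm := by
  rw [form, IsSymm, transpose_mul, transpose_mul, transpose_transpose, perfect_isSymm.eq,
    Matrix.mul_assoc]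

/-- The basis of the symmetric matrices dual to the squares of the roots, up to a factor `2`. -/
def coroot : Fin 6 → Matrix (Fin 3) (Fin 3) ℤ :=
  ![!![2, 1, 1; 1, 0, 0; 1, 0, 0], !![0, 1, 0; 1, 2, 1; 0, 1, 0], !![0, 0, 1; 0, 0, 1; 1, 1, 2],
    !![0, -1, 0; -1, 0, 0; 0, 0, 0], !![0, 0, 0; 0, 0, -1; 0, -1, 0],
    !![0, 0, -1; 0, 0, 0; -1, 0, 0]]

theorem two_smul_eq_sum_coroot {A : Matrix (Fin 3) (Fin 3) ℤ} (hA : A.IsSymm) :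
    (2 : ℤ) • A = ∑ i, qf A (root i) • coroot i := by
  have h01 := hA.apply 0 1
  have h02 := hA.apply 0 2
  have h12 := hA.apply 1 2
  ext a b
  fin_cases a <;> fin_cases b <;>
  · simp only [Matrix.sum_apply, Matrix.smul_apply, smul_eq_mul, Fin.sum_univ_six]
    simp [qf, root, coroot, dotProduct, mulVec, Fin.sum_univ_three]
    linarith

/-- The dual basis of the frame of `g`. -/
def covec (g : SpecialLinearGroup (Fin 3) ℤ) (i : Fin 6) : Matrix (Fin 3) (Fin 3) ℤ :=
  g.1ᵀ * coroot i * g.1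

theorem two_smul_eq_sum {A : Matrix (Fin 3) (Fin 3) ℤ} (hA : A.IsSymm)
    (g : SpecialLinearGroup (Fin 3) ℤ) :
    (2 : ℤ) • A = ∑ i, qf A (vec g i) • covec g i := by
  have hg := inv_mul_val g
  have hsymm : ((g⁻¹).1ᵀ * A * (g⁻¹).1).IsSymm := by
    rw [IsSymm, transpose_mul, transpose_mul, transpose_transpose, hA.eq, Matrix.mul_assoc]
  have h := congrArg (fun M => g.1ᵀ * M * g.1) (two_smul_eq_sum_coroot hsymm)
  simp only [qf_congr, Matrix.mul_sum, Matrix.sum_mul, Matrix.mul_smul, Matrix.smul_mul] at h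
  rw [show (∑ i, qf A (vec g i) • covec g i) = (2 : ℤ) • (g.1ᵀ * ((g⁻¹).1ᵀ * A * (g⁻¹).1) * g.1)
    from h.symm]
  congr 1
  rw [Matrix.mul_assoc, Matrix.mul_assoc, Matrix.mul_assoc, hg, Matrix.mul_one, ← Matrix.mul_assoc,
    ← transpose_mul, hg, transpose_one, Matrix.one_mul]

theorem covec_isSymm (g : SpecialLinearGroup (Fin 3) ℤ) (i : Fin 6) : (covec g i).IsSymm := by
  have : (coroot i).IsSymm := by revert i; decide
  rw [covec, IsSymm, transpose_mul, transpose_mul, transpose_transpose, this.eq, Matrix.mul_assoc]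

theorem coroot_ne_zero (i : Fin 6) : coroot i ≠ 0 := by revert i; decide

theorem covec_ne_zero (g : SpecialLinearGroup (Fin 3) ℤ) (i : Fin 6) : covec g i ≠ 0 := by
  intro h
  have hg := mul_inv_val g
  apply coroot_ne_zero i
  have h1 : (g⁻¹).1ᵀ * covec g i * (g⁻¹).1 = coroot i := by
    rw [covec, Matrix.mul_assoc, Matrix.mul_assoc, Matrix.mul_assoc, hg, Matrix.mul_one,
      ← Matrix.mul_assoc, ← transpose_mul, hg, transpose_one, Matrix.one_mul]
  rw [← h1, h, Matrix.mul_zero, Matrix.zero_mul]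

/-- The coordinates of a symmetric matrix, ordered lexicographically starting with the trace. -/
def height : Matrix (Fin 3) (Fin 3) ℤ →+ Lex (Fin 6 → ℤ) where
  toFun C := toLex ![C 0 0 + C 1 1 + C 2 2, C 0 0, C 1 1, C 0 1, C 0 2, C 1 2]
  map_zero' := by
    apply toLex.injective.eq_iff.2
    decide
  map_add' C D := by
    apply toLex.injective.eq_iff.2
    ext i
    fin_cases i <;> simp
    ring

theorem height_injective {C D : Matrix (Fin 3) (Fin 3) ℤ} (hC : C.IsSymm) (hD : D.IsSymm)
    (h : height C = height D) : C = D := by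
  have h' : ∀ i : Fin 6, ofLex (height C) i = ofLex (height D) i := fun i => by rw [h]
  have h0 : C 0 0 + C 1 1 + C 2 2 = D 0 0 + D 1 1 + D 2 2 := h' 0
  have h1 : C 0 0 = D 0 0 := h' 1
  have h2 : C 1 1 = D 1 1 := h' 2
  have h3 : C 0 1 = D 0 1 := h' 3
  have h4 : C 0 2 = D 0 2 := h' 4
  have h5 : C 1 2 = D 1 2 := h' 5
  have c01 := hC.apply 0 1
  have c02 := hC.apply 0 2
  have c12 := hC.apply 1 2
  have d01 := hD.apply 0 1
  have d02 := hD.apply 0 2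
  have d12 := hD.apply 1 2
  ext a b
  fin_cases a <;> fin_cases b <;> simp only [Fin.zero_eta, Fin.mk_one, Fin.reduceFinMk] <;> omega

theorem trace_le_of_height_le {C D : Matrix (Fin 3) (Fin 3) ℤ} (h : height C ≤ height D) :
    C 0 0 + C 1 1 + C 2 2 ≤ D 0 0 + D 1 1 + D 2 2 := by
  rcases h.eq_or_lt with h | h
  · exact (congrFun (congrArg ofLex h) 0).le
  · obtain ⟨i, hi, hlt⟩ := h
    rcases eq_or_ne i 0 with rfl | h0
    · exact hlt.le
    · exact (hi 0 (Fin.pos_of_ne_zero h0)).le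

/-- The height of the perfect form of `g`. -/
def level (g : SpecialLinearGroup (Fin 3) ℤ) : Lex (Fin 6 → ℤ) := height (form g)

/-- The height of a dual basis vector. -/
def slope (g : SpecialLinearGroup (Fin 3) ℤ) (i : Fin 6) : Lex (Fin 6 → ℤ) := height (covec g i)

theorem slope_ne_zero (g : SpecialLinearGroup (Fin 3) ℤ) (i : Fin 6) : slope g i ≠ 0 := fun h =>
  covec_ne_zero g i
    (height_injective (covec_isSymm g i) isSymm_zero (h.trans (map_zero height).symm))

theorem two_smul_height {A : Matrix (Fin 3) (Fin 3) ℤ} (hA : A.IsSymm)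
    (g : SpecialLinearGroup (Fin 3) ℤ) :
    (2 : ℤ) • height A = ∑ i, qf A (vec g i) • slope g i := by
  rw [← map_zsmul, two_smul_eq_sum hA g, map_sum]
  simp only [map_zsmul, slope]

theorem two_smul_level_sub (g g' : SpecialLinearGroup (Fin 3) ℤ) :
    (2 : ℤ) • level g' - (2 : ℤ) • level g = ∑ i, (qf (form g') (vec g i) - 2) • slope g i := by
  rw [level, level, two_smul_height (form_isSymm g') g, two_smul_height (form_isSymm g) g,
    ← Finset.sum_sub_distrib]
  simp only [qf_form_vec, sub_smul]

theorem le_zero_of_two_smul {x : Lex (Fin 6 → ℤ)} (h : (2 : ℤ) • x ≤ 0) : x ≤ 0 := by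
  by_contra hx
  have := add_pos (not_le.1 hx) (not_le.1 hx)
  rw [two_zsmul] at h
  exact absurd h (not_le.2 this)

theorem zsmul_nonpos {n : ℤ} (hn : 0 ≤ n) {x : Lex (Fin 6 → ℤ)} (hx : x ≤ 0) : n • x ≤ 0 := by
  have := zsmul_nonneg (neg_nonneg.2 hx) hn
  rwa [zsmul_neg, neg_nonneg] at this

theorem level_le (g g' : SpecialLinearGroup (Fin 3) ℤ)
    (h : ∀ i, 0 < slope g i → sq (vec g i) ∈ system.frame g') : level g' ≤ level g := by
  rw [← sub_nonpos]
  apply le_zero_of_two_smul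
  rw [zsmul_sub, two_smul_level_sub]
  apply Finset.sum_nonpos
  intro i _
  rcases lt_or_ge 0 (slope g i) with hi | hi
  · rw [(qf_form_eq_two_iff g' (vec_ne_zero g i)).2 (h i hi), sub_self, zero_smul]
  · exact zsmul_nonpos (sub_nonneg.2 (two_le_qf_form g' (vec_ne_zero g i))) hi

/-- Changes of frame that preserve all the vertices except one. -/
def flip : Fin 6 → SpecialLinearGroup (Fin 3) ℤ :=
  ![⟨!![-1, -1, -1; -1, 0, 0; 1, 1, 0], by simp [det_fin_three]⟩,
    ⟨!![-1, -1, -1; 0, -1, 0; 0, 1, 1], by simp [det_fin_three]⟩,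
    ⟨!![-1, -1, -1; 0, 0, -1; 1, 0, 1], by simp [det_fin_three]⟩,
    ⟨!![-1, 0, -1; 0, -1, 0; 0, 1, 1], by simp [det_fin_three]⟩,
    ⟨!![-1, -1, 0; 0, 0, -1; 1, 0, 1], by simp [det_fin_three]⟩,
    ⟨!![-1, -1, 0; 0, 0, -1; 1, 0, 0], by simp [det_fin_three]⟩]

theorem sq_flip_mem_base (i k : Fin 6) : sq ((flip i).1 *ᵥ root k) ∈ base ↔ k ≠ i := by
  revert i k
  decide

theorem sq_vec_mem_frame_flip (g : SpecialLinearGroup (Fin 3) ℤ) (i k : Fin 6) :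
    sq (vec g k) ∈ system.frame (flip i * g) ↔ k ≠ i := by
  rw [FrameSystem.mem_frame, mul_smul, smul_sq_vec, smul_sq]
  exact sq_flip_mem_base i k

theorem level_lt_flip (g : SpecialLinearGroup (Fin 3) ℤ) {i : Fin 6} (hi : 0 < slope g i) :
    level g < level (flip i * g) := by
  by_contra hlt
  have h : (2 : ℤ) • (level (flip i * g) - level g) ≤ 0 :=
    zsmul_nonpos (by norm_num) (sub_nonpos.2 (not_lt.1 hlt))
  rw [zsmul_sub, two_smul_level_sub, Finset.sum_eq_single i] at h
  · have h2 := two_le_qf_form (flip i * g) (vec_ne_zero g i)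
    have h3 : qf (form (flip i * g)) (vec g i) ≠ 2 := fun h4 =>
      (sq_vec_mem_frame_flip g i i).1 ((qf_form_eq_two_iff _ (vec_ne_zero g i)).1 h4) rfl
    exact absurd h (not_le.2 (zsmul_pos hi (by omega)))
  · intro k _ hk
    rw [(qf_form_eq_two_iff _ (vec_ne_zero g k)).2 ((sq_vec_mem_frame_flip g i k).2 hk), sub_self,
      zero_smul]
  · exact fun h => absurd (Finset.mem_univ i) h

theorem sum_sq_le_trace_form (g : SpecialLinearGroup (Fin 3) ℤ) (a b : Fin 3) :
    g.1 a b ^ 2 ≤ form g 0 0 + form g 1 1 + form g 2 2 := by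
  have key : ∀ b, form g b b = qf perfect fun a => g.1 a b := fun b => by
    rw [form, qf, Matrix.mul_assoc, mul_apply]
    rfl
  simp only [key, qf_perfect]
  fin_cases a <;> fin_cases b <;>
    simp only [Fin.zero_eta, Fin.mk_one, Fin.reduceFinMk] <;> nlinarith

theorem finite_level_lt (g : SpecialLinearGroup (Fin 3) ℤ) :
    (Set.range level ∩ Set.Iio (level g)).Finite := by
  set T := form g 0 0 + form g 1 1 + form g 2 2 with hT
  have hfin : (Set.univ.pi fun _ : Fin 3 => Set.univ.pi fun _ : Fin 3 =>
      Set.Icc (-T) T).Finite :=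
    Set.Finite.pi fun _ => Set.Finite.pi fun _ => Set.finite_Icc _ _
  have hfin' : {g' : SpecialLinearGroup (Fin 3) ℤ | level g' < level g}.Finite := by
    refine Set.Finite.of_finite_image (f := fun g' a b => g'.1 a b) (hfin.subset ?_)
      fun g₁ _ g₂ _ h => ?_
    · rintro _ ⟨g', hg', rfl⟩ a - b -
      have h1 := (sum_sq_le_trace_form g' a b).trans (trace_le_of_height_le (le_of_lt hg'))
      rw [← hT] at h1
      exact ⟨by nlinarith, by nlinarith⟩
    · ext a b
      exact congrFun (congrFun h a) b
  refine (hfin'.image level).subset ?_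
  rintro _ ⟨⟨g', rfl⟩, hg'⟩
  exact ⟨g', hg', rfl⟩

/-- The position of the level of `g` among all levels. -/
noncomputable def rank (g : SpecialLinearGroup (Fin 3) ℤ) : ℕ :=
  (Set.range level ∩ Set.Iio (level g)).ncard

theorem rank_le_rank_iff {g g' : SpecialLinearGroup (Fin 3) ℤ} :
    rank g' ≤ rank g ↔ level g' ≤ level g := by
  constructor
  · intro h
    by_contra hlt
    rw [not_le] at hlt
    refine absurd h (not_le.2 (Set.ncard_lt_ncard ⟨?_, fun hsub => ?_⟩ (finite_level_lt g')))
    · exact fun y hy => ⟨hy.1, lt_trans hy.2 hlt⟩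
    · exact lt_irrefl (level g) (hsub ⟨⟨g, rfl⟩, hlt⟩).2
  · intro h
    exact Set.ncard_le_ncard (fun y hy => ⟨hy.1, lt_of_lt_of_le hy.2 h⟩) (finite_level_lt g)

theorem frame_eq_of_level_eq {g g' : SpecialLinearGroup (Fin 3) ℤ} (h : level g = level g') :
    system.frame g = system.frame g' := by
  have key : ∀ {g g' : SpecialLinearGroup (Fin 3) ℤ}, level g = level g' →
      system.frame g ⊆ system.frame g' := by
    intro g g' h X hX
    obtain ⟨i, rfl⟩ := mem_frame_iff.1 hX
    rw [← qf_form_eq_two_iff g' (vec_ne_zero g i),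
      ← height_injective (form_isSymm g) (form_isSymm g') h, qf_form_vec]
  exact (key h).antisymm (key h.symm)

/-- The vertices of the frame of `g` with negative slope. -/
def free (g : SpecialLinearGroup (Fin 3) ℤ) : Set Form :=
  {X | ∃ i, X = sq (vec g i) ∧ slope g i < 0}

theorem sq_vec_mem_free {g : SpecialLinearGroup (Fin 3) ℤ} {i : Fin 6} :
    sq (vec g i) ∈ free g ↔ slope g i < 0 :=
  ⟨fun ⟨_, hj, h⟩ => sq_vec_injective g hj ▸ h, fun h => ⟨i, rfl, h⟩⟩

theorem mem_core {g : SpecialLinearGroup (Fin 3) ℤ} {i : Fin 6} (hi : 0 < slope g i) :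
    sq (vec g i) ∈ system.frame g \ free g :=
  ⟨mem_frame_iff.2 ⟨i, rfl⟩, fun h => lt_asymm hi (sq_vec_mem_free.1 h)⟩

theorem full_core (g : SpecialLinearGroup (Fin 3) ℤ) : Full (system.frame g \ free g) := by
  intro w hw
  by_contra hw0
  have hA : (vecMulVec w w).IsSymm := transpose_vecMulVec w w
  have hle : height (vecMulVec w w) ≤ height 0 := by
    rw [map_zero]
    apply le_zero_of_two_smul
    rw [two_smul_height hA g]
    apply Finset.sum_nonpos
    intro i _
    have hq : qf (vecMulVec w w) (vec g i) = (vec g i ⬝ᵥ w) ^ 2 := qf_sq w (vec g i)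
    rcases lt_or_ge 0 (slope g i) with hi | hi
    · have h0 := hw _ (mem_core hi)
      rw [qf_sq, dotProduct_comm] at h0
      rw [hq, h0, zero_smul]
    · exact zsmul_nonpos (by rw [hq]; positivity) hi
  have htr := trace_le_of_height_le hle
  simp only [vecMulVec_apply, Matrix.zero_apply] at htr
  apply hw0
  have h0 : w 0 = 0 := mul_self_eq_zero.1 (by
    linarith [mul_self_nonneg (w 0), mul_self_nonneg (w 1), mul_self_nonneg (w 2)])
  have h1 : w 1 = 0 := mul_self_eq_zero.1 (by
    linarith [mul_self_nonneg (w 0), mul_self_nonneg (w 1), mul_self_nonneg (w 2)])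
  have h2 : w 2 = 0 := mul_self_eq_zero.1 (by
    linarith [mul_self_nonneg (w 0), mul_self_nonneg (w 1), mul_self_nonneg (w 2)])
  ext a
  fin_cases a
  exacts [h0, h1, h2]

/-- The shelling of the Voronoi tessellation by height. -/
noncomputable def shelling : system.Shelling where
  free := free
  rank := rank
  free_subset := by
    rintro g _ ⟨i, rfl, -⟩
    exact mem_frame_iff.2 ⟨i, rfl⟩
  full_core := full_core
  isMax_iff := by
    intro n t g _ ht
    simp only [rank_le_rank_iff]
    constructor
    · rintro h X ⟨hX, hfree⟩
      obtain ⟨i, rfl⟩ := mem_frame_iff.1 hX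
      have hi : 0 < slope g i := lt_of_le_of_ne
        (not_lt.1 fun hi => hfree (sq_vec_mem_free.2 hi)) (slope_ne_zero g i).symm
      by_contra hrange
      refine absurd (h (flip i * g) fun j => ?_) (not_le.2 (level_lt_flip g hi))
      obtain ⟨k, hk⟩ := mem_frame_iff.1 (ht j)
      rw [hk, sq_vec_mem_frame_flip]
      rintro rfl
      exact hrange ⟨j, hk⟩
    · intro h g' hg'
      apply level_le
      intro i hi
      obtain ⟨j, hj⟩ := h (mem_core hi)
      exact hj ▸ hg' j
  frame_eq g g' h :=
    frame_eq_of_level_eq ((rank_le_rank_iff.1 h.le).antisymm (rank_le_rank_iff.1 h.ge))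
  frame_eq_of_free_eq_empty := by
    have key : ∀ g g', free g = ∅ → level g ≤ level g' := by
      intro g g' h
      rw [← sub_nonpos]
      apply le_zero_of_two_smul
      rw [zsmul_sub, ← neg_sub, two_smul_level_sub, neg_nonpos]
      refine Finset.sum_nonneg fun i _ => zsmul_nonneg (not_lt.1 fun hi => ?_)
        (sub_nonneg.2 (two_le_qf_form g' (vec_ne_zero g i)))
      exact (Set.ext_iff.1 h _).1 (sq_vec_mem_free.2 hi)
    intro g g' h h'
    exact frame_eq_of_level_eq ((key g g' h).antisymm (key g' g h'))

/-- The maximal sets of roots that do not span. -/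
def degenerate : Fin 7 → Finset (Fin 6) :=
  ![{2, 3}, {1, 2, 4}, {0, 2, 5}, {0, 4}, {1, 5}, {3, 4, 5}, {0, 1, 3}]

/-- Vectors orthogonal to the degenerate sets of roots. -/
def normal : Fin 7 → Fin 3 → ℤ :=
  ![![-1, -1, 0], ![-1, 0, 0], ![0, -1, 0], ![0, -1, -1], ![-1, 0, -1], ![-1, -1, -1], ![0, 0, -1]]

theorem normal_ne_zero : ∀ k, normal k ≠ 0 := by decide

theorem normal_dotProduct_root : ∀ k, ∀ i ∈ degenerate k, normal k ⬝ᵥ root i = 0 := by decide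

theorem exists_degenerate_of_card_le_two :
    ∀ s : Finset (Fin 6), s.card < 3 → ∃ k, s ⊆ degenerate k := by
  decide

/-- Sets of roots on which the corresponding element of `transposer` acts by a transposition. -/
def swappable : Fin 13 → Finset (Fin 6) :=
  ![{0, 2, 3, 4, 5}, {0, 1, 2, 3, 5}, {0, 1, 2, 4, 5}, {0, 1, 2, 3, 5}, {0, 1, 3, 4, 5},
    {0, 1, 2, 3, 4}, {0, 2, 3, 4, 5}, {0, 1, 3, 4, 5}, {0, 2, 3, 5}, {1, 2, 3, 4}, {0, 1, 2, 4},
    {1, 2, 3, 4, 5}, {1, 2, 4, 5}]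

/-- The roots exchanged by the corresponding element of `transposer`. -/
def exchanged : Fin 13 → Fin 6 × Fin 6 :=
  ![(3, 4), (1, 3), (1, 4), (2, 5), (4, 5), (2, 4), (0, 2), (0, 1), (0, 5), (1, 4), (1, 2), (1, 2),
    (2, 4)]

/-- Matrices acting on a set of roots by a transposition. -/
def transposer : Fin 13 → SpecialLinearGroup (Fin 3) ℤ :=
  ![⟨!![-1, -1, 0; 0, 1, 0; 0, -1, -1], by simp [det_fin_three]⟩,
    ⟨!![-1, -1, 0; 0, 1, 0; 0, 0, -1], by simp [det_fin_three]⟩,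
    ⟨!![-1, 0, 0; 0, 1, 0; 0, -1, -1], by simp [det_fin_three]⟩,
    ⟨!![-1, 0, -1; 0, -1, 0; 0, 0, 1], by simp [det_fin_three]⟩,
    ⟨!![-1, 0, -1; 0, -1, -1; 0, 0, 1], by simp [det_fin_three]⟩,
    ⟨!![-1, 0, 0; 0, -1, -1; 0, 0, 1], by simp [det_fin_three]⟩,
    ⟨!![0, 1, 1; 0, -1, 0; 1, 1, 0], by simp [det_fin_three]⟩,
    ⟨!![0, 1, 1; 1, 0, 1; 0, 0, -1], by simp [det_fin_three]⟩,
    ⟨!![-1, 0, 0; 0, -1, 0; 1, 1, 1], by simp [det_fin_three]⟩,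
    ⟨!![-1, 0, 0; 0, -1, 0; 1, 1, 1], by simp [det_fin_three]⟩,
    ⟨!![-1, 0, 0; 0, 0, -1; 0, -1, 0], by simp [det_fin_three]⟩,
    ⟨!![-1, 0, 0; 1, 0, 1; 1, 1, 0], by simp [det_fin_three]⟩,
    ⟨!![-1, 0, 0; 1, 1, 1; 0, 0, -1], by simp [det_fin_three]⟩]

theorem exchanged_ne : ∀ m, (exchanged m).1 ≠ (exchanged m).2 := by decide

theorem sq_transposer : ∀ m, ∀ i ∈ swappable m, sq ((transposer m).1 *ᵥ root i) =
    sq (root (Equiv.swap (exchanged m).1 (exchanged m).2 i)) := by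
  decide

theorem exists_degenerate_or_swappable : ∀ s : Finset (Fin 6), s ≠ Finset.univ →
    (∃ k, s ⊆ degenerate k) ∨
      ∃ m, (exchanged m).1 ∈ s ∧ (exchanged m).2 ∈ s ∧ s ⊆ swappable m := by
  decide

theorem not_subset_degenerate {n : ℕ} {t : Fin n → Form} {g : SpecialLinearGroup (Fin 3) ℤ}
    {σ : Fin n → Fin 6} (hσ : ∀ j, g • t j = sq (root (σ j))) (ht : Full (Set.range t))
    (k : Fin 7) : ¬ Finset.univ.image σ ⊆ degenerate k := by
  intro hk
  apply normal_ne_zero k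
  apply full_smul g t ht
  rintro _ ⟨j, rfl⟩
  change qf (g • t j).mat _ = 0
  rw [hσ, qf_sq, normal_dotProduct_root k _
    (hk (Finset.mem_image_of_mem σ (Finset.mem_univ j)))]
  rfl

theorem exists_root_of_isCell {n : ℕ} {t : Fin n → Form} (ht : system.IsCell t) :
    ∃ (g : SpecialLinearGroup (Fin 3) ℤ) (σ : Fin n → Fin 6), ∀ j, g • t j = sq (root (σ j)) := by
  obtain ⟨-, g, hg⟩ := ht
  choose σ hσ using fun j => mem_base.1 (hg j)
  exact ⟨g, σ, hσ⟩

theorem not_isCell_of_lt {n : ℕ} (hn : n < 3) (t : Fin n → Form) : ¬ system.IsCell t := by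
  intro ht
  obtain ⟨g, σ, hσ⟩ := exists_root_of_isCell ht
  obtain ⟨k, hk⟩ := exists_degenerate_of_card_le_two (Finset.univ.image σ)
    (lt_of_le_of_lt Finset.card_image_le (by simpa using hn))
  exact not_subset_degenerate hσ ht.1 k hk

theorem exists_odd_symmetry {n : ℕ} (hn : n < 6) (t : Fin n → Form) (ht : system.IsCell t)
    (hinj : Function.Injective t) : ∃ (g : SpecialLinearGroup (Fin 3) ℤ) (π : Equiv.Perm (Fin n)),
      Equiv.Perm.sign π = -1 ∧ g • t = t ∘ π := by
  obtain ⟨g, σ, hσ⟩ := exists_root_of_isCell ht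
  have hσinj : Function.Injective σ := fun a b hab => by
    apply hinj
    rw [← inv_smul_smul g (t a), hσ, hab, ← hσ, inv_smul_smul]
  have hne : Finset.univ.image σ ≠ Finset.univ := by
    intro h
    have h1 := Finset.card_image_of_injective Finset.univ hσinj
    rw [h, Finset.card_univ, Finset.card_univ, Fintype.card_fin, Fintype.card_fin] at h1
    omega
  rcases exists_degenerate_or_swappable _ hne with ⟨k, hk⟩ | ⟨m, hx, hy, hm⟩
  · exact absurd hk (not_subset_degenerate hσ ht.1 k)
  obtain ⟨a, -, ha⟩ := Finset.mem_image.1 hx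
  obtain ⟨b, -, hb⟩ := Finset.mem_image.1 hy
  refine ⟨g⁻¹ * transposer m * g, Equiv.swap a b, Equiv.Perm.sign_swap ?_, ?_⟩
  · rintro rfl
    exact exchanged_ne m (ha.symm.trans hb)
  · ext1 j
    change (g⁻¹ * transposer m * g) • t j = t (Equiv.swap a b j)
    rw [mul_smul, mul_smul, hσ, smul_sq, sq_transposer m _
      (hm (Finset.mem_image_of_mem σ (Finset.mem_univ j))), ← ha, ← hb, hσinj.swap_apply, ← hσ,
      inv_smul_smul]

/-- The row of the `p`-th entry of the upper triangle. -/
def row : Fin 6 → Fin 3 := ![0, 1, 2, 0, 1, 0]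

/-- The column of the `p`-th entry of the upper triangle. -/
def col : Fin 6 → Fin 3 := ![0, 1, 2, 1, 2, 2]

/-- The coordinates of `X + Xᵀ`. -/
def coords (X : Form) (p : Fin 6) : ℤ := X.mat (row p) (col p) + X.mat (col p) (row p)

/-- The matrix of the action of `M` on symmetric matrices. -/
def symSq {R : Type*} [CommRing R] (M : Matrix (Fin 3) (Fin 3) R) : Matrix (Fin 6) (Fin 6) R :=
  of fun p q => if row q = col q then M (row p) (row q) * M (col p) (row q)
    else M (row p) (row q) * M (col p) (col q) + M (row p) (col q) * M (col p) (row q)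

theorem symSq_map {R S : Type*} [CommRing R] [CommRing S] (f : R →+* S)
    (M : Matrix (Fin 3) (Fin 3) R) : symSq (M.map f) = (symSq M).map f := by
  ext p q
  simp only [symSq, of_apply, map_apply]
  split_ifs <;> simp

theorem symSq_mul {R : Type*} [CommRing R] (M N : Matrix (Fin 3) (Fin 3) R) :
    symSq (M * N) = symSq M * symSq N := by
  ext p q
  simp only [symSq, of_apply, mul_apply, Fin.sum_univ_three, Fin.sum_univ_six]
  fin_cases q <;> simp [row, col] <;> ring

theorem coords_smul (g : SpecialLinearGroup (Fin 3) ℤ) (X : Form) :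
    coords (g • X) = symSq g.1 *ᵥ coords X := by
  ext p
  simp only [coords, symSq, smul_mat, mulVec, dotProduct, of_apply, mul_apply, transpose_apply,
    Fin.sum_univ_three, Fin.sum_univ_six]
  simp [row, col]
  ring

theorem det_symSq_diagonal (D : Fin 3 → ℚ) :
    (symSq (diagonal D)).det = (diagonal D).det ^ 4 := by
  have : symSq (diagonal D) = diagonal fun p => D (row p) * D (col p) := by
    ext p q
    fin_cases p <;> fin_cases q <;> simp [symSq, row, col, diagonal]
  rw [this, det_diagonal, det_diagonal, Fin.prod_univ_six, Fin.prod_univ_three]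
  simp only [row, col, cons_val]
  ring

theorem det_symSq_transvection (i j : Fin 3) (hij : i ≠ j) (c : ℚ) :
    (symSq (transvection i j c)).det = 1 := by
  set D : Fin 3 → ℚ := Function.update 1 i 2 with hD
  have hcomm : diagonal D * transvection i j c = transvection i j (c + c) * diagonal D := by
    ext a b
    rw [diagonal_mul, mul_diagonal, hD]
    revert hij
    fin_cases i <;> fin_cases j <;> fin_cases a <;> fin_cases b <;>
      simp [transvection, one_apply] <;> ring
  have hD0 : (symSq (diagonal D)).det ≠ 0 := by
    rw [det_symSq_diagonal, det_diagonal, hD, Fin.prod_univ_three]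
    fin_cases i <;> simp
  have h1 : symSq (1 : Matrix (Fin 3) (Fin 3) ℚ) = 1 := by
    ext p q
    fin_cases p <;> fin_cases q <;> simp [symSq, row, col, one_apply]
  have hinv : (symSq (transvection i j c)).det * (symSq (transvection i j (-c))).det = 1 := by
    rw [← det_mul, ← symSq_mul, transvection_mul_transvection_same i j hij, add_neg_cancel,
      transvection_zero, h1, det_one]
  have h := congrArg (fun M => (symSq M).det) hcomm
  simp only [← transvection_mul_transvection_same i j hij, symSq_mul, det_mul] at h
  have hT0 : (symSq (transvection i j c)).det ≠ 0 := left_ne_zero_of_mul_eq_one hinv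
  rw [mul_comm] at h
  have h' := mul_right_cancel₀ hD0 h
  exact (mul_right_cancel₀ hT0 ((one_mul _).trans h')).symm

theorem det_symSq (M : Matrix (Fin 3) (Fin 3) ℚ) (hM : M.det ≠ 0) :
    (symSq M).det = M.det ^ 4 := by
  refine diagonal_transvection_induction_of_det_ne_zero
    (fun M => (symSq M).det = M.det ^ 4) M hM (fun D _ => det_symSq_diagonal D) (fun t => ?_)
    fun A B _ _ hA hB => ?_
  · rw [TransvectionStruct.det, one_pow]
    exact det_symSq_transvection t.i t.j t.hij t.c
  · rw [symSq_mul, det_mul, det_mul, hA, hB, mul_pow]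

theorem det_symSq_specialLinearGroup (g : SpecialLinearGroup (Fin 3) ℤ) :
    (symSq g.1).det = 1 := by
  apply Int.cast_injective (α := ℚ)
  have hdet : (g.1.map (Int.castRingHom ℚ)).det = 1 := by
    rw [← RingHom.mapMatrix_apply, ← RingHom.map_det, g.2, map_one]
  have h := det_symSq (g.1.map (Int.castRingHom ℚ)) (by rw [hdet]; exact one_ne_zero)
  rw [hdet, symSq_map, ← RingHom.mapMatrix_apply, ← RingHom.map_det, one_pow] at h
  simpa using h

/-- The orientation of a tuple of symmetric matrices. -/
def orientation (t : Fin 6 → Form) : ℚ := ((of fun j => coords (t j)).det : ℤ)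

theorem orientation_comp (t : Fin 6 → Form) (π : Equiv.Perm (Fin 6)) :
    orientation (t ∘ π) = (Equiv.Perm.sign π : ℤ) * orientation t := by
  have h := det_permute π (of fun j => coords (t j))
  rw [orientation, orientation, ← Int.cast_mul]
  exact congrArg _ h

theorem orientation_smul (g : SpecialLinearGroup (Fin 3) ℤ) (t : Fin 6 → Form) :
    orientation (g • t) = orientation t := by
  have h : (of fun j => coords ((g • t) j)) = (of fun j => coords (t j)) * (symSq g.1)ᵀ := by
    ext j p
    change coords (g • t j) p = _
    rw [coords_smul, mul_apply]
    simp only [mulVec, dotProduct, of_apply, transpose_apply, mul_comm]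
  rw [orientation, orientation, h, det_mul, det_transpose, det_symSq_specialLinearGroup, mul_one]

theorem orientation_root_ne_zero : orientation (fun i => sq (root i)) ≠ 0 := by
  rw [orientation, Int.cast_ne_zero, det_of_isLowerTriangular]
  · decide
  · have h : ∀ i p : Fin 6, i < p → coords (sq (root i)) p = 0 := by decide
    exact fun i p hip => h i p hip

theorem orientation_ne_zero (t : Fin 6 → Form) (g : SpecialLinearGroup (Fin 3) ℤ)
    (hinj : Function.Injective t) (ht : Set.range t = system.frame g) : orientation t ≠ 0 := by
  have hex : ∀ j, ∃ i, g • t j = sq (root i) := fun j => mem_base.1 (ht.subset ⟨j, rfl⟩)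
  choose σ hσ using hex
  have hσinj : Function.Injective σ := fun a b hab => by
    apply hinj
    rw [← inv_smul_smul g (t a), hσ, hab, ← hσ, inv_smul_smul]
  let π : Equiv.Perm (Fin 6) := Equiv.ofBijective σ (Finite.injective_iff_bijective.1 hσinj)
  have h : g • t = (fun i => sq (root i)) ∘ π := funext hσ
  rw [← orientation_smul g, h, orientation_comp]
  exact mul_ne_zero (Int.cast_ne_zero.2 (Units.ne_zero _)) orientation_root_ne_zero

end Form

/-- **Soulé.** The rational cohomology of `SL₃(ℤ)` is that of a point: for every `k ≥ 1`,
`H^k(SL₃(ℤ); ℚ) = 0`. -/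
theorem sl3_z_rational_cohomology_trivial (k : ℕ) (hk : 1 ≤ k) :
    Subsingleton
      (groupCohomology (Rep.trivial ℚ (Matrix.SpecialLinearGroup (Fin 3) ℤ) ℚ) k) := by
  exact Form.system.subsingleton_groupCohomology Form.shelling
    ((Finset.card_image_of_injective _ Form.sq_root_injective).trans (by simp))
    (fun n hn t => Form.not_isCell_of_lt hn t) (fun n hn t => Form.exists_odd_symmetry hn t)
    Form.orientation_comp Form.orientation_ne_zero Form.orientation_smul k hk
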